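/- arXiv:2207.11787 — 2 statements merged into one kernel-verified Lean document; each statement's English description precedes it below -/
import Mathlib

section
/- Let N ∈ ℕ and let φ_1, …, φ_N : ℕ → ℤ be asymptotically linearly independent sequences. Then there exist a strictly increasing sequence (n_k)_{k∈ℕ} in ℕ and, for each ξ = (ξ_1,…,ξ_N) ∈ {0,1}^N, a continuous symmetric Borel probability measure σ_ξ on 𝕋 such that for every j ∈ {1,…,N} and every m ∈ ℤ, lim_{k→∞} ∫_𝕋 e^{2πi(φ_j(n_k)+m)x} dσ_ξ(x) = (1 − ξ_j) ∫_𝕋 e^{2πimx} dσ_ξ(x). -/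
open Filter Topology MeasureTheory

noncomputable section

/-- The lattice box whose sides are `[0, L)` in the directions of `A` and `{0}` in the others. -/
def latticeBox {N : ℕ} (A : Finset (Fin N)) (L : ℕ) : Finset (Fin N → ℤ) :=
  Fintype.piFinset fun j => if j ∈ A then Finset.Ico 0 (L : ℤ) else {0}

/-- The effect on Fourier coefficients of multiplying a measure on the circle by
`|∑ b ∈ B, fourier (b ⬝ᵥ v)| ^ 2 / |B|`. -/
def squareTwist {N : ℕ} (B : Finset (Fin N → ℤ)) (v : Fin N → ℤ) (c : ℤ → ℂ) (q : ℤ) : ℂ :=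
  (B.card : ℂ)⁻¹ * ∑ b ∈ B, ∑ b' ∈ B, c (q + (b - b') ⬝ᵥ v)

/-- Fourier coefficients of the partial generalized Riesz products along `v`. -/
def rieszCoeff {N : ℕ} (A : Finset (Fin N)) (v : ℕ → Fin N → ℤ) : ℕ → ℤ → ℂ
  | 0 => Pi.single 0 1
  | k + 1 => squareTwist (latticeBox A (k + 1)) (v k) (rieszCoeff A v k)

section Measures

lemma integrable_fourier (μ : Measure UnitAddCircle) [IsFiniteMeasure μ] (q : ℤ) :
    Integrable (fun x => fourier q x) μ :=
  Integrable.of_bound (fourier q).continuous.aestronglyMeasurable 1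
    (ae_of_all _ fun x => by simpa only [fourier_apply] using (Circle.norm_coe _).le)

lemma normSq_sum_fourier {ι : Type*} (B : Finset ι) (f : ι → ℤ) (x : UnitAddCircle) :
    ((Complex.normSq (∑ b ∈ B, fourier (f b) x) : ℝ) : ℂ) =
      ∑ b ∈ B, ∑ b' ∈ B, fourier (f b - f b') x := by
  rw [Complex.normSq_eq_conj_mul_self, mul_comm, map_sum, Finset.sum_mul_sum]
  simp_rw [← fourier_neg, ← fourier_add, ← sub_eq_add_neg]

lemma exists_measure_squareTwist {N : ℕ} (B : Finset (Fin N → ℤ)) (v : Fin N → ℤ)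
    (μ : Measure UnitAddCircle) [IsProbabilityMeasure μ] (c : ℤ → ℂ)
    (hμ : ∀ q : ℤ, ∫ x, fourier q x ∂μ = c q) (h : squareTwist B v c 0 = 1) :
    ∃ ν : Measure UnitAddCircle, IsProbabilityMeasure ν ∧
      ∀ q : ℤ, ∫ x, fourier q x ∂ν = squareTwist B v c q := by
  set p : UnitAddCircle → ℝ := fun x =>
    (B.card : ℝ)⁻¹ * Complex.normSq (∑ b ∈ B, fourier (b ⬝ᵥ v) x) with hp
  have hp0 : ∀ x, 0 ≤ p x := fun x => mul_nonneg (by positivity) (Complex.normSq_nonneg _)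
  have hpc : Continuous p := by
    refine continuous_const.mul (Complex.continuous_normSq.comp ?_)
    exact continuous_finsetSum _ fun b _ => (fourier _).continuous
  set ν := μ.withDensity fun x => ENNReal.ofReal (p x) with hν
  have hint : ∀ q : ℤ, ∫ x, fourier q x ∂ν = squareTwist B v c q := by
    intro q
    rw [hν, integral_withDensity_eq_integral_toReal_smul (by fun_prop)
      (ae_of_all _ fun x => ENNReal.ofReal_lt_top)]
    have : ∀ x, (ENNReal.ofReal (p x)).toReal • (fourier q x : ℂ) =
        (B.card : ℂ)⁻¹ * ∑ b ∈ B, ∑ b' ∈ B, fourier (q + (b - b') ⬝ᵥ v) x := by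
      intro x
      rw [ENNReal.toReal_ofReal (hp0 x), Complex.real_smul, hp]
      push_cast
      rw [normSq_sum_fourier B (fun b => b ⬝ᵥ v) x, mul_assoc, Finset.sum_mul]
      simp_rw [Finset.sum_mul, sub_dotProduct, add_comm q, fourier_add]
    simp_rw [this]
    rw [integral_const_mul, integral_finsetSum]
    · simp_rw [squareTwist, ← hμ]
      congr 1
      refine Finset.sum_congr rfl fun b _ => ?_
      rw [integral_finsetSum]
      exact fun b' _ => integrable_fourier μ _
    · exact fun b _ => integrable_finsetSum _ fun b' _ => integrable_fourier μ _
  refine ⟨ν, ⟨?_⟩, hint⟩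
  have h1 := hint 0
  rw [h] at h1
  simp only [fourier_zero, integral_const, Complex.real_smul, mul_one] at h1
  have h2 : (ν Set.univ).toReal = 1 := by exact_mod_cast h1
  rwa [ENNReal.toReal_eq_one_iff] at h2

lemma exists_measure_of_forall_eventually_eq (c : ℕ → ℤ → ℂ) (c' : ℤ → ℂ)
    (h : ∀ k, ∃ μ : Measure UnitAddCircle, IsProbabilityMeasure μ ∧
      ∀ q : ℤ, ∫ x, fourier q x ∂μ = c k q)
    (hc : ∀ q, ∀ᶠ k in atTop, c k q = c' q) :
    ∃ μ : Measure UnitAddCircle, IsProbabilityMeasure μ ∧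
      ∀ q : ℤ, ∫ x, fourier q x ∂μ = c' q := by
  choose μ hμ hμc using h
  set P : ℕ → ProbabilityMeasure UnitAddCircle := fun k => ⟨μ k, hμ k⟩
  obtain ⟨ν, hν⟩ : ∃ ν, ClusterPt ν (map P atTop) := exists_clusterPt_of_compactSpace _
  refine ⟨ν, inferInstance, fun q => ?_⟩
  obtain ⟨U, hU, hUν⟩ := mapClusterPt_iff_ultrafilter.1 hν
  rw [ProbabilityMeasure.tendsto_iff_forall_integral_rclike_tendsto ℂ] at hUν
  have h1 := hUν (BoundedContinuousFunction.mkOfCompact (fourier q))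
  refine tendsto_nhds_unique h1 (tendsto_const_nhds.congr' ?_)
  filter_upwards [hU (hc q)] with k hk
  rw [← hk, ← hμc]
  rfl

lemma measure_singleton_le (μ : Measure UnitAddCircle) [IsProbabilityMeasure μ] (s : ℤ) (K : ℕ)
    (h : ∀ i : ℤ, i ≠ 0 → |i| ≤ K → ∫ x, fourier (i * s) x ∂μ = 0) (x : UnitAddCircle) :
    ((K : ℝ) + 1) * μ.real {x} ≤ 1 := by
  set f : UnitAddCircle → ℝ := fun y => Complex.normSq
    (∑ i ∈ Finset.range (K + 1), fourier (i * s) (y - x)) with hf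
  have hf0 : ∀ y, 0 ≤ f y := fun y => Complex.normSq_nonneg _
  have hfc : Continuous f := by
    refine Complex.continuous_normSq.comp ?_
    exact continuous_finsetSum _ fun b _ => (fourier _).continuous.comp (by fun_prop)
  have hfi : Integrable f μ := by
    obtain ⟨C, hC⟩ := isCompact_univ.exists_bound_of_continuousOn hfc.continuousOn
    exact Integrable.of_bound hfc.aestronglyMeasurable C (ae_of_all _ fun y => hC y trivial)
  have hfx : f x = ((K : ℝ) + 1) ^ 2 := by
    simp only [hf, sub_self, fourier_eval_zero, Finset.sum_const, Finset.card_range, nsmul_eq_mul,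
      mul_one]
    rw [Complex.normSq_natCast]
    push_cast
    ring
  have hsplit : ∀ (q : ℤ) (y : UnitAddCircle),
      (fourier q (y - x) : ℂ) = fourier (-q) x * fourier q y := by
    intro q y
    simp only [fourier_apply, ← Circle.coe_mul, ← AddCircle.toCircle_add]
    congr 2
    rw [zsmul_sub, neg_zsmul]
    abel
  have hint : ∫ y, f y ∂μ = (K : ℝ) + 1 := by
    rw [← Complex.ofReal_inj, ← integral_complex_ofReal]
    simp only [hf]
    simp_rw [normSq_sum_fourier (Finset.range (K + 1)) (fun i => (i : ℤ) * s), hsplit]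
    rw [integral_finsetSum _ fun i _ => integrable_finsetSum _ fun i' _ =>
      (integrable_fourier μ _).const_mul _]
    have : ∀ i ∈ Finset.range (K + 1), ∫ y, ∑ i' ∈ Finset.range (K + 1),
        fourier (-((i : ℤ) * s - i' * s)) x * (fourier ((i : ℤ) * s - i' * s) y : ℂ) ∂μ = 1 := by
      intro i hi
      rw [integral_finsetSum _ fun i' _ => (integrable_fourier μ _).const_mul _,
        Finset.sum_eq_single i]
      · simp
      · intro i' hi' hne
        rw [integral_const_mul, ← sub_mul, h, mul_zero]
        · omega
        · simp only [Finset.mem_range] at hi hi'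
          rw [abs_le]
          omega
      · exact fun hi' => absurd hi hi'
    rw [Finset.sum_congr rfl this]
    simp
  have hle : ((K : ℝ) + 1) ^ 2 * μ.real {x} ≤ (K : ℝ) + 1 := by
    rw [← hfx, ← hint]
    calc f x * μ.real {x} = ∫ y in {x}, f y ∂μ := by
          rw [integral_singleton, smul_eq_mul, mul_comm]
      _ ≤ ∫ y, f y ∂μ := setIntegral_le_integral hfi (ae_of_all _ hf0)
  have hK : (0 : ℝ) < K + 1 := by positivity
  nlinarith

end Measures

section Boxes

variable {N : ℕ} {A : Finset (Fin N)} {L : ℕ}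

lemma mem_latticeBox {b : Fin N → ℤ} :
    b ∈ latticeBox A L ↔ ∀ j, if j ∈ A then 0 ≤ b j ∧ b j < L else b j = 0 := by
  rw [latticeBox, Fintype.mem_piFinset]
  refine forall_congr' fun j => ?_
  split_ifs <;> simp

lemma abs_sub_le_of_mem_latticeBox {b b' : Fin N → ℤ} {k : ℕ} (hb : b ∈ latticeBox A (k + 1))
    (hb' : b' ∈ latticeBox A (k + 1)) (j : Fin N) : |b j - b' j| ≤ k := by
  have h := mem_latticeBox.1 hb j
  have h' := mem_latticeBox.1 hb' j
  rw [abs_le]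
  split_ifs at h h' <;> push_cast at * <;> constructor <;> omega

lemma card_latticeBox_ne_zero (k : ℕ) : ((latticeBox A (k + 1)).card : ℂ) ≠ 0 := by
  rw [Nat.cast_ne_zero, Finset.card_ne_zero]
  refine ⟨0, mem_latticeBox.2 fun j => ?_⟩
  split_ifs <;> simp

lemma card_latticeBox_shift (k : ℕ) (j : Fin N) :
    (k + 1) * ((latticeBox A (k + 1)).filter
      fun b => b + Pi.single j 1 ∈ latticeBox A (k + 1)).card =
      (if j ∈ A then k else 0) * (latticeBox A (k + 1)).card := by
  by_cases hj : j ∈ A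
  · have h1 : (latticeBox A (k + 1)).filter (fun b => b + Pi.single j 1 ∈ latticeBox A (k + 1)) =
        Fintype.piFinset fun i => if i = j then Finset.Ico 0 (k : ℤ) else
          if i ∈ A then Finset.Ico 0 ((k + 1 : ℕ) : ℤ) else {0} := by
      ext b
      simp only [Finset.mem_filter, mem_latticeBox, Fintype.mem_piFinset, ← forall_and]
      refine forall_congr' fun i => ?_
      by_cases hij : i = j
      · subst hij
        simp [hj]
        omega
      · by_cases hi : i ∈ A <;> simp [hij, hi]
    rw [h1, latticeBox, Fintype.card_piFinset, Fintype.card_piFinset,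
      ← Finset.mul_prod_erase _ _ (Finset.mem_univ j),
      ← Finset.mul_prod_erase (a := j) _ (fun i => (ite (i ∈ A) _ _ : Finset ℤ).card)
        (Finset.mem_univ j)]
    have h2 : ∀ i ∈ Finset.univ.erase j, (if i = j then Finset.Ico 0 (k : ℤ) else
        if i ∈ A then Finset.Ico 0 ((k + 1 : ℕ) : ℤ) else {0}).card =
        (if i ∈ A then Finset.Ico 0 ((k + 1 : ℕ) : ℤ) else {0}).card := fun i hi => by
      rw [if_neg (Finset.ne_of_mem_erase hi)]
    rw [Finset.prod_congr rfl h2]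
    simp only [hj, if_true, Int.card_Ico]
    simp only [sub_zero, Int.toNat_natCast]
    ring
  · rw [if_neg hj, zero_mul, Finset.filter_false_of_mem, Finset.card_empty, mul_zero]
    intro b hb hb'
    have h := mem_latticeBox.1 hb j
    have h' := mem_latticeBox.1 hb' j
    simp [hj] at h h'
    omega

end Boxes

section Coefficients

variable {N : ℕ} {A : Finset (Fin N)} {v : ℕ → Fin N → ℤ} {d : ℕ → ℤ}

lemma abs_dotProduct_le {a v : Fin N → ℤ} {C : ℤ} (h : ∀ j, |a j| ≤ C) :
    |a ⬝ᵥ v| ≤ C * ∑ j, |v j| := by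
  rw [dotProduct, Finset.mul_sum]
  refine (Finset.abs_sum_le_sum_abs _ _).trans (Finset.sum_le_sum fun j _ => ?_)
  rw [abs_mul]
  exact mul_le_mul_of_nonneg_right (h j) (abs_nonneg _)

lemma rieszCoeff_neg (k : ℕ) (q : ℤ) :
    rieszCoeff A v k (-q) = rieszCoeff A v k q := by
  induction k generalizing q with
  | zero =>
    by_cases hq : q = 0 <;> simp [rieszCoeff, hq]
  | succ k ih =>
    simp only [rieszCoeff, squareTwist]
    rw [Finset.sum_comm]
    congr 1
    refine Finset.sum_congr rfl fun b _ => Finset.sum_congr rfl fun b' _ => ?_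
    rw [← ih]
    congr 1
    simp only [sub_dotProduct]
    ring

/-- The degree bounds `d` of the partial Riesz products along `v`, and the separation of each `v k`
from the preceding ones. -/
structure IsLacunary (v : ℕ → Fin N → ℤ) (d : ℕ → ℤ) : Prop where
  zero : d 0 = 0
  succ : ∀ k : ℕ, d (k + 1) = d k + (k + 1) * ∑ j, |v k j|
  gap : ∀ (k : ℕ) (a : Fin N → ℤ), a ≠ 0 → (∀ j, |a j| ≤ k + 2) →
    (k + 2) * (d k + k + 1) < |a ⬝ᵥ v k|

namespace IsLacunary

lemma monotone (hv : IsLacunary v d) : Monotone d := by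
  refine monotone_nat_of_le_succ fun k => ?_
  rw [hv.succ]
  have : (0 : ℤ) ≤ (k + 1) * ∑ j, |v k j| := by positivity
  omega

lemma nonneg (hv : IsLacunary v d) (k : ℕ) : 0 ≤ d k :=
  hv.zero ▸ hv.monotone (Nat.zero_le k)

lemma rieszCoeff_eq_zero (hv : IsLacunary v d) (k : ℕ) {q : ℤ} (hq : d k < |q|) :
    rieszCoeff A v k q = 0 := by
  induction k generalizing q with
  | zero =>
    have : q ≠ 0 := by
      rintro rfl
      simp [hv.zero] at hq
    simp [rieszCoeff, this]
  | succ k ih =>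
    rw [rieszCoeff, squareTwist, Finset.sum_eq_zero, mul_zero]
    refine fun b hb => Finset.sum_eq_zero fun b' hb' => ih ?_
    have h1 := abs_dotProduct_le (v := v k) (abs_sub_le_of_mem_latticeBox hb hb')
    change |(b - b') ⬝ᵥ v k| ≤ _ at h1
    have h2 := abs_sub_abs_le_abs_add q ((b - b') ⬝ᵥ v k)
    have h3 : (0 : ℤ) ≤ ∑ j, |v k j| := by positivity
    rw [hv.succ] at hq
    linarith

lemma rieszCoeff_add_eq_zero (hv : IsLacunary v d) (k : ℕ) {q : ℤ} {a : Fin N → ℤ}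
    (hq : |q| ≤ (k + 1) * (d k + k + 1)) (ha : a ≠ 0) (hak : ∀ j, |a j| ≤ k + 2) :
    rieszCoeff A v k (q + a ⬝ᵥ v k) = 0 := by
  refine hv.rieszCoeff_eq_zero k ?_
  have h1 := hv.gap k a ha hak
  have h2 := abs_sub_abs_le_abs_add (a ⬝ᵥ v k) q
  rw [add_comm q]
  linarith

lemma rieszCoeff_succ (hv : IsLacunary v d) (k : ℕ) {q : ℤ}
    (hq : |q| ≤ (k + 1) * (d k + k + 1)) :
    rieszCoeff A v (k + 1) q = rieszCoeff A v k q := by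
  rw [rieszCoeff, squareTwist]
  have : ∀ b ∈ latticeBox A (k + 1), ∑ b' ∈ latticeBox A (k + 1),
      rieszCoeff A v k (q + (b - b') ⬝ᵥ v k) = rieszCoeff A v k q := by
    intro b hb
    rw [Finset.sum_eq_single b]
    · simp
    · intro b' hb' hne
      refine hv.rieszCoeff_add_eq_zero k hq (sub_ne_zero.2 hne.symm) fun j => ?_
      have := abs_sub_le_of_mem_latticeBox hb hb' j
      rw [Pi.sub_apply]
      omega
    · exact fun h => absurd hb h
  rw [Finset.sum_congr rfl this, Finset.sum_const, nsmul_eq_mul,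
    inv_mul_cancel_left₀ (card_latticeBox_ne_zero k)]

lemma rieszCoeff_succ_add (hv : IsLacunary v d) (k : ℕ) (j : Fin N) {q : ℤ}
    (hq : |q| ≤ (k + 1) * (d k + k + 1)) :
    rieszCoeff A v (k + 1) (v k j + q) =
      (if j ∈ A then (k : ℂ) / (k + 1) else 0) * rieszCoeff A v k q := by
  rw [rieszCoeff, squareTwist]
  set B := latticeBox A (k + 1) with hBdef
  have hsum : ∀ b ∈ B, ∑ b' ∈ B, rieszCoeff A v k (v k j + q + (b - b') ⬝ᵥ v k) =
      if b + Pi.single j 1 ∈ B then rieszCoeff A v k q else 0 := by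
    intro b hb
    have hterm : ∀ b' ∈ B, rieszCoeff A v k (v k j + q + (b - b') ⬝ᵥ v k) =
        if b' = b + Pi.single j 1 then rieszCoeff A v k q else 0 := by
      intro b' hb'
      have : v k j + q + (b - b') ⬝ᵥ v k = q + (b + Pi.single j 1 - b') ⬝ᵥ v k := by
        rw [add_sub_right_comm, add_dotProduct, single_dotProduct]
        ring
      rw [this]
      split_ifs with h
      · simp [h]
      · refine hv.rieszCoeff_add_eq_zero k hq (sub_ne_zero.2 (Ne.symm h)) fun i => ?_
        have h1 := abs_sub_le_of_mem_latticeBox hb hb' i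
        have h2 : |(Pi.single j 1 : Fin N → ℤ) i| ≤ 1 := by
          by_cases hij : i = j
          · subst hij; simp
          · simp [hij]
        rw [Pi.sub_apply, Pi.add_apply, add_sub_right_comm]
        have h3 := abs_add_le (b i - b' i) ((Pi.single j 1 : Fin N → ℤ) i)
        linarith
    rw [Finset.sum_congr rfl hterm, Finset.sum_ite_eq']
  rw [Finset.sum_congr rfl hsum, ← Finset.sum_filter, Finset.sum_const, nsmul_eq_mul, ← mul_assoc]
  congr 1
  have hcard := congrArg (Nat.cast : ℕ → ℂ) (card_latticeBox_shift (A := A) k j)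
  push_cast at hcard
  rw [← hBdef] at hcard
  have hB : (B.card : ℂ) ≠ 0 := card_latticeBox_ne_zero k
  have hk : (k : ℂ) + 1 ≠ 0 := by exact_mod_cast k.succ_ne_zero
  rw [inv_mul_eq_iff_eq_mul₀ hB]
  apply mul_left_cancel₀ hk
  rw [hcard]
  split_ifs
  · field_simp
  · simp

lemma window_mono (hv : IsLacunary v d) {k m : ℕ} (hkm : k ≤ m) :
    ((k : ℤ) + 1) * (d k + k + 1) ≤ (m + 1) * (d m + m + 1) := by
  have h1 := hv.monotone hkm
  have h2 := hv.nonneg k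
  have h3 : (k : ℤ) ≤ m := by exact_mod_cast hkm
  exact mul_le_mul (by linarith) (by linarith) (by positivity) (by positivity)

lemma rieszCoeff_eq_of_le (hv : IsLacunary v d) {k m : ℕ} (hkm : k ≤ m) {q : ℤ}
    (hq : |q| ≤ (k + 1) * (d k + k + 1)) :
    rieszCoeff A v m q = rieszCoeff A v k q := by
  induction m, hkm using Nat.le_induction with
  | base => rfl
  | succ m hkm ih => rw [hv.rieszCoeff_succ m (hq.trans (hv.window_mono hkm)), ih]

lemma le_window (hv : IsLacunary v d) (k : ℕ) : d k + k + 1 ≤ ((k : ℤ) + 1) * (d k + k + 1) := by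
  have := hv.nonneg k
  exact le_mul_of_one_le_left (by positivity) (by omega)

lemma exists_measure_rieszCoeff (hv : IsLacunary v d) (A : Finset (Fin N)) (k : ℕ) :
    ∃ μ : Measure UnitAddCircle, IsProbabilityMeasure μ ∧
      ∀ q : ℤ, ∫ x, fourier q x ∂μ = rieszCoeff A v k q := by
  induction k with
  | zero =>
    refine ⟨AddCircle.haarAddCircle, inferInstance, fun q => ?_⟩
    have h := congrFun (fourierCoeff_fourier (T := 1) 0) (-q)
    simp only [fourierCoeff, neg_neg, fourier_zero, smul_eq_mul, mul_one] at h
    rw [h, rieszCoeff]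
    by_cases hq : q = 0 <;> simp [hq]
  | succ k ih =>
    obtain ⟨μ, hμ, hμc⟩ := ih
    refine exists_measure_squareTwist _ _ μ _ hμc ?_
    change rieszCoeff A v (k + 1) 0 = 1
    rw [hv.rieszCoeff_eq_of_le (Nat.zero_le _) (by simp [hv.zero])]
    simp [rieszCoeff]

theorem exists_measure (hv : IsLacunary v d) (A : Finset (Fin N)) :
    ∃ σ : Measure UnitAddCircle, IsProbabilityMeasure σ ∧
      (∀ x : UnitAddCircle, σ {x} = 0) ∧
      (∀ q : ℤ, ∫ x, fourier q x ∂σ = ∫ x, fourier (-q) x ∂σ) ∧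
      ∀ j q, Tendsto (fun k => ∫ x, fourier (v k j + q) x ∂σ) atTop
        (𝓝 ((if j ∈ A then 1 else 0) * ∫ x, fourier q x ∂σ)) := by
  have hnn := hv.nonneg
  have hlim : ∀ (q : ℤ) (k : ℕ), |q| ≤ k → |q| ≤ (k + 1) * (d k + k + 1) := fun q k hk => by
    have := hv.le_window k
    have := hnn k
    omega
  obtain ⟨σ, hσ, hσc⟩ := exists_measure_of_forall_eventually_eq (rieszCoeff A v)
    (fun q => rieszCoeff A v q.natAbs q) (hv.exists_measure_rieszCoeff A) fun q => by
      filter_upwards [eventually_ge_atTop q.natAbs] with k hk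
      exact hv.rieszCoeff_eq_of_le hk (hlim _ _ (by simp))
  have hcoeff : ∀ (k : ℕ) (q : ℤ), |q| ≤ (k + 1) * (d k + k + 1) →
      ∫ x, fourier q x ∂σ = rieszCoeff A v k q := by
    intro k q hq
    rw [hσc, ← hv.rieszCoeff_eq_of_le (le_max_left q.natAbs k) (hlim _ _ (by simp)),
      hv.rieszCoeff_eq_of_le (le_max_right q.natAbs k) hq]
  refine ⟨σ, hσ, fun x => ?_, fun q => ?_, fun j q => ?_⟩
  · have hle : ∀ k : ℕ, ((k : ℝ) + 1) * σ.real {x} ≤ 1 := by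
      intro k
      have hk := hnn k
      refine measure_singleton_le σ (d k + k + 1) k (fun i hi hik => ?_) x
      have habs : |i * (d k + k + 1)| = |i| * (d k + k + 1) := by
        rw [abs_mul, abs_of_pos (a := d k + k + 1) (by positivity)]
      have hi1 : 1 ≤ |i| := Int.one_le_abs hi
      rw [hcoeff k, hv.rieszCoeff_eq_zero k]
      · rw [habs]
        nlinarith
      · rw [habs]
        exact mul_le_mul_of_nonneg_right (by omega) (by positivity)
    rw [← measureReal_eq_zero_iff]
    by_contra hne
    have hpos : 0 < σ.real {x} := lt_of_le_of_ne measureReal_nonneg (Ne.symm hne)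
    obtain ⟨k, hk⟩ := exists_nat_gt (σ.real {x})⁻¹
    have := hle k
    rw [inv_lt_iff_one_lt_mul₀ hpos] at hk
    nlinarith
  · rw [hσc, hσc, rieszCoeff_neg, Int.natAbs_neg]
  · have hev : (fun k : ℕ => (if j ∈ A then (k : ℂ) / (k + 1) else 0) * ∫ x, fourier q x ∂σ)
        =ᶠ[atTop] fun k => ∫ x, fourier (v k j + q) x ∂σ := by
      filter_upwards [eventually_ge_atTop q.natAbs] with k hk
      have hqk : |q| ≤ k := by
        rw [Int.abs_eq_natAbs]
        exact_mod_cast hk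
      rw [hcoeff k q (hlim q k hqk), hcoeff (k + 1), hv.rieszCoeff_succ_add k j (hlim q k hqk)]
      refine le_trans ?_ (hv.le_window (k + 1))
      rw [hv.succ]
      have h1 : |v k j| ≤ ∑ j, |v k j| :=
        Finset.single_le_sum (f := fun j => |v k j|) (fun i _ => abs_nonneg _) (Finset.mem_univ j)
      have h2 : (0 : ℤ) ≤ k * ∑ j, |v k j| := by positivity
      have h3 := abs_add_le (v k j) q
      have h4 := hnn k
      push_cast
      linarith
    refine Tendsto.congr' hev (Tendsto.mul_const _ ?_)
    split_ifs
    · exact tendsto_natCast_div_add_atTop 1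
    · exact tendsto_const_nhds

end IsLacunary

end Coefficients

lemma exists_strictMono_isLacunary {N : ℕ} (φ : Fin N → ℕ → ℤ)
    (hφ : ∀ a : Fin N → ℤ, a ≠ 0 → Tendsto (fun n => |∑ j, a j * φ j n|) atTop atTop) :
    ∃ (n : ℕ → ℕ) (d : ℕ → ℤ), StrictMono n ∧ IsLacunary (fun k j => φ j (n k)) d := by
  have hex : ∀ (k : ℕ) (G : ℤ) (m : ℕ), ∃ n, m < n ∧ ∀ a : Fin N → ℤ, a ≠ 0 →
      (∀ j, |a j| ≤ k + 2) → G < |a ⬝ᵥ fun j => φ j n| := by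
    intro k G m
    have hfin : (Fintype.piFinset fun _ : Fin N =>
        Finset.Icc (-((k : ℤ) + 2)) (k + 2) : Set (Fin N → ℤ)).Finite := Finset.finite_toSet _
    have h1 : ∀ᶠ n in atTop, ∀ a ∈ (Fintype.piFinset fun _ : Fin N =>
        Finset.Icc (-((k : ℤ) + 2)) (k + 2)), a ≠ 0 → G < |a ⬝ᵥ fun j => φ j n| := by
      rw [Finset.eventually_all]
      intro a _
      by_cases ha : a = 0
      · simp [ha]
      · filter_upwards [(hφ a ha).eventually_gt_atTop G] with n hn _ using hn
    obtain ⟨n, hn, hmn⟩ := (h1.and (eventually_gt_atTop m)).exists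
    refine ⟨n, hmn, fun a ha hak => hn a ?_ ha⟩
    exact Fintype.mem_piFinset.2 fun j => Finset.mem_Icc.2 (abs_le.1 (hak j))
  choose f hf hfgap using hex
  let s : ℕ → ℕ × ℤ := fun k => Nat.rec (0, 0) (fun k p =>
    (f k ((k + 2) * (p.2 + k + 1)) p.1,
      p.2 + (k + 1) * ∑ j, |φ j (f k ((k + 2) * (p.2 + k + 1)) p.1)|)) k
  refine ⟨fun k => (s (k + 1)).1, fun k => (s k).2, strictMono_nat_of_lt_succ fun k => ?_,
    rfl, fun k => rfl, fun k a ha hak => ?_⟩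
  · exact hf (k + 1) _ _
  · exact hfgap k _ _ a ha hak

/-- For asymptotically linearly independent `φ_1,…,φ_N : ℕ → ℤ`, there
are a strictly increasing `(n_k)` in ℕ and, for each `ξ ∈ {0,1}^N`, a continuous
(atomless) symmetric Borel probability measure `σ_ξ` on `𝕋 = ℝ/ℤ` with
`∫ e^{2πi(φ_j(n_k)+m)x} dσ_ξ → (1-ξ_j) ∫ e^{2πimx} dσ_ξ` for every `j` and `m ∈ ℤ`.
Here `fourier n x = e^{2πinx}` on `UnitAddCircle = ℝ/ℤ`. -/
theorem stmt_12 (N : ℕ) (φ : Fin N → ℕ → ℤ)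
    (hφ : ∀ a : Fin N → ℤ, a ≠ 0 →
      Tendsto (fun n => |∑ j, a j * φ j n|) atTop atTop) :
    ∃ n : ℕ → ℕ, StrictMono n ∧
      ∀ ξ : Fin N → ℝ, (∀ j, ξ j = 0 ∨ ξ j = 1) →
        ∃ σ : Measure UnitAddCircle, IsProbabilityMeasure σ ∧
          (∀ x : UnitAddCircle, σ {x} = 0) ∧
          (∀ q : ℤ, ∫ x, fourier q x ∂σ = ∫ x, fourier (-q) x ∂σ) ∧
          (∀ j : Fin N, ∀ q : ℤ,
            Tendsto (fun k => ∫ x, fourier (φ j (n k) + q) x ∂σ) atTop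
              (𝓝 (((1 - ξ j : ℝ) : ℂ) * ∫ x, fourier q x ∂σ))) := by
  obtain ⟨n, d, hn, hv⟩ := exists_strictMono_isLacunary φ hφ
  refine ⟨n, hn, fun ξ hξ => ?_⟩
  classical
  obtain ⟨σ, hσ, hatom, hsymm, hlim⟩ := hv.exists_measure (Finset.univ.filter fun j => ξ j = 0)
  refine ⟨σ, hσ, hatom, hsymm, fun j q => ?_⟩
  convert hlim j q using 3
  rcases hξ j with h | h <;> simp [h]
end
end

section
/- Let N ≥ 2, let A_1, …, A_{2^N−2} be an enumeration of the non-empty proper subsets of {1,…,N}, let p_1, …, p_{2^N−2} ∈ ℕ be distinct prime numbers, and for each j ∈ {1,…,N} set q_j = Π_{n ∈ {1,…,2^N−2} : j ∈ A_n} p_n and φ_j(k) = q_j k for k ∈ ℕ. Then there exists a strictly increasing sequence (n_k)_{k∈ℕ} in ℕ such that for every ξ = (ξ_1,…,ξ_N) ∈ {0,1}^N there exists a weakly mixing T_ξ ∈ Aut([0,1], ℬ, μ) with the property that for each j ∈ {1,…,N} and all measurable A, B ⊆ [0,1], lim_{k→∞} μ(A ∩ T_ξ^{−q_j n_k} B)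 = (1 − ξ_j) μ(A ∩ B) + ξ_j μ(A) μ(B). -/
open MeasureTheory Filter Topology

noncomputable section

/-- An invertible Lebesgue-measure-preserving transformation of `[0,1]`. -/
structure Aut01 : Type where
  toEquiv : unitInterval ≃ unitInterval
  measurePreserving_toFun :
    MeasurePreserving toEquiv (volume : Measure unitInterval) volume
  measurePreserving_invFun :
    MeasurePreserving toEquiv.symm (volume : Measure unitInterval) volume

namespace Aut01

/-- The correlation `μ(A ∩ T^{-m} B)` (as a real number). -/
def corr (T : Aut01) (m : ℤ) (A B : Set unitInterval) : ℝ :=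
  (volume (A ∩ ⇑(T.toEquiv ^ m : Equiv.Perm unitInterval) ⁻¹' B)).toReal

/-- The dyadic interval `[k/2^ℓ, (k+1)/2^ℓ)` of rank `ℓ`, as a subset of `[0,1]`. -/
def dyadic (ℓ k : ℕ) : Set unitInterval :=
  {x | (k : ℝ) / 2 ^ ℓ ≤ (x : ℝ) ∧ (x : ℝ) < ((k : ℝ) + 1) / 2 ^ ℓ}

/-- The metric `∂(T,S) = Σ_{ℓ≥1} 2^{-2ℓ} Σ_{E of rank ℓ} μ(TE △ SE)` inducing the weak
topology on `Aut01`. -/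
def wDist (T S : Aut01) : ℝ :=
  ∑' ℓ : ℕ,
    (1 / 2 ^ (2 * (ℓ + 1)) : ℝ) *
      ∑ k ∈ Finset.range (2 ^ (ℓ + 1)),
        (volume (symmDiff (T.toEquiv '' dyadic (ℓ + 1) k) (S.toEquiv '' dyadic (ℓ + 1) k))).toReal

/-- The weak topology on `Aut01`, generated by the balls of the metric `wDist`. -/
instance : TopologicalSpace Aut01 :=
  TopologicalSpace.generateFrom
    {U | ∃ (T : Aut01) (ε : ℝ), 0 < ε ∧ U = {S | wDist T S < ε}}

/-- `T` is aperiodic: the set of periodic points has measure zero. -/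
def Aperiodic (T : Aut01) : Prop :=
  volume {x : unitInterval |
    ∃ n : ℕ, 0 < n ∧ (T.toEquiv ^ n : Equiv.Perm unitInterval) x = x} = 0

/-- `T` is weakly mixing. -/
def WeaklyMixing (T : Aut01) : Prop :=
  ∀ A B : Set unitInterval, MeasurableSet A → MeasurableSet B →
    Tendsto
      (fun M : ℕ =>
        (1 / (M : ℝ)) *
          ∑ n ∈ Finset.Icc 1 M,
            |T.corr (n : ℤ) A B - (volume A).toReal * (volume B).toReal|)
      atTop (𝓝 0)

end Aut01


/-- A measure on `ι → ℝ` is the law of a centred Gaussian family with the covariances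
`⟪v i, v j⟫`: expressed through its characteristic function. -/
def HasGramCharFun {ι H : Type*} [NormedAddCommGroup H] [InnerProductSpace ℝ H]
    (γ : Measure (ι → ℝ)) (v : ι → H) : Prop :=
  ∀ s : ι →₀ ℝ, ∫ x, Complex.exp ((Finsupp.linearCombination ℝ x s : ℝ) * Complex.I) ∂γ =
    Complex.exp (-(‖Finsupp.linearCombination ℝ v s‖ ^ 2 / 2 : ℝ))

lemma measurable_linearCombination {ι : Type*} (s : ι →₀ ℝ) :
    Measurable fun x : ι → ℝ => Finsupp.linearCombination ℝ x s := by
  simp only [Finsupp.linearCombination_apply, Finsupp.sum]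
  fun_prop

/-- Finite measures on a countable product of lines are determined by the characteristic
functions of their finite-dimensional marginals. -/
lemma measure_ext_of_linearCombination {ι : Type*} [Countable ι] {P P' : Measure (ι → ℝ)}
    [IsFiniteMeasure P] [IsFiniteMeasure P']
    (h : ∀ s : ι →₀ ℝ,
      ∫ x, Complex.exp ((Finsupp.linearCombination ℝ x s : ℝ) * Complex.I) ∂P =
        ∫ x, Complex.exp ((Finsupp.linearCombination ℝ x s : ℝ) * Complex.I) ∂P') :
    P = P' := by
  let _ := TopologicalSpace.upgradeIsCompletelyMetrizable (ι → ℝ)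
  let _ : TopologicalSpace (ι →₀ ℝ) := ⊥
  have : DiscreteTopology (ι →₀ ℝ) := ⟨rfl⟩
  have hL : Continuous fun p : (ι → ℝ) × (ι →₀ ℝ) =>
      Finsupp.bilinearCombination ℝ ℝ p.1 p.2 := by
    refine continuous_prod_of_discrete_right.2 fun s => ?_
    simp only [Finsupp.bilinearCombination_apply, Finsupp.linearCombination_apply, Finsupp.sum]
    fun_prop
  refine ext_of_integral_char_eq (W := ι →₀ ℝ) (L := Finsupp.bilinearCombination ℝ ℝ)
    Real.continuous_probChar Real.probChar_ne_one ?_ hL ?_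
  · intro x hx hx0
    refine hx (funext fun i => ?_)
    simpa [Finsupp.bilinearCombination_apply] using DFunLike.congr_fun hx0 (Finsupp.single i 1)
  · intro s
    simpa [Real.probChar_apply, Finsupp.bilinearCombination_apply] using h s

section GramSchmidt

open InnerProductSpace

variable {H : Type*} [NormedAddCommGroup H] [InnerProductSpace ℝ H]

lemma sum_inner_gramSchmidtNormed (u : ℕ → H) (K : ℕ) {x : H}
    (hx : x ∈ Submodule.span ℝ (u '' Set.Iio K)) :
    ∑ i ∈ Finset.range K, inner ℝ (gramSchmidtNormed ℝ u i) x • gramSchmidtNormed ℝ u i = x := by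
  rw [← span_gramSchmidt_Iio, ← span_gramSchmidtNormed] at hx
  induction hx using Submodule.span_induction with
  | mem x hx =>
    obtain ⟨j, hj, rfl⟩ := hx
    rw [Finset.sum_eq_single j]
    · by_cases h0 : gramSchmidtNormed ℝ u j = 0
      · simp [h0]
      · rw [real_inner_self_eq_norm_sq, gramSchmidtNormed_unit_length' h0]
        simp
    · intro i _ hij
      have : inner ℝ (gramSchmidtNormed ℝ u i) (gramSchmidtNormed ℝ u j) = 0 := by
        simp [gramSchmidtNormed, inner_smul_left, inner_smul_right,
          gramSchmidt_orthogonal ℝ u hij]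
      simp [this]
    · intro h
      exact absurd (Finset.mem_range.2 hj) h
  | zero => simp
  | add x y _ _ hx hy =>
    simp only [inner_add_right, add_smul, Finset.sum_add_distrib, hx, hy]
  | smul a x _ hx =>
    simp only [inner_smul_right, mul_smul, ← Finset.smul_sum, hx]

lemma sum_inner_gramSchmidtNormed_sq (u : ℕ → H) (K : ℕ) {x : H}
    (hx : x ∈ Submodule.span ℝ (u '' Set.Iio K)) :
    ∑ i ∈ Finset.range K, inner ℝ (gramSchmidtNormed ℝ u i) x ^ 2 = ‖x‖ ^ 2 := by
  have h := congrArg (inner ℝ · x) (sum_inner_gramSchmidtNormed u K hx)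
  simpa [sum_inner, inner_smul_left, ← sq] using h

open ProbabilityTheory in
lemma integral_exp_sum_gaussian (c : ℕ → ℝ) (K : ℕ) :
    ∫ g, Complex.exp ((∑ i ∈ Finset.range K, c i * g i : ℝ) * Complex.I)
        ∂Measure.infinitePi (fun _ : ℕ => gaussianReal 0 1) =
      Complex.exp (-((∑ i ∈ Finset.range K, c i ^ 2) / 2 : ℝ)) := by
  have hind := iIndepFun_infinitePi (P := fun _ : ℕ => gaussianReal 0 1)
    (X := fun i (y : ℝ) => c i * y) (fun i => by fun_prop)
  have h1 := (hind.restrict (Finset.range K)).charFun_map_fun_finsetSum_eq_prod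
    (fun i _ => Measurable.aemeasurable (by fun_prop))
  have h2 := congrFun h1 1
  rw [charFun_apply_real, integral_map (Measurable.aemeasurable (by fun_prop)) (by fun_prop)] at h2
  simp only [Complex.ofReal_one, one_mul] at h2
  rw [h2, Finset.prod_apply]
  have h3 : ∀ i, charFun (Measure.map (fun g : ℕ → ℝ => c i * g i)
      (Measure.infinitePi fun _ : ℕ => gaussianReal 0 1)) 1 =
      Complex.exp (-(c i ^ 2 / 2 : ℝ)) := by
    intro i
    rw [show (fun g : ℕ → ℝ => c i * g i) = (fun y => c i * y) ∘ (fun g => g i) from rfl,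
      ← Measure.map_map (by fun_prop) (by fun_prop), Measure.infinitePi_map_eval,
      gaussianReal_map_const_mul, charFun_gaussianReal]
    congr 1
    push_cast
    simp
  simp_rw [h3, ← Complex.exp_sum]
  congr 1
  push_cast
  rw [Finset.sum_neg_distrib, Finset.sum_div]

lemma exists_hasGramCharFun_nat (u : ℕ → H) :
    ∃ γ : Measure (ℕ → ℝ), IsProbabilityMeasure γ ∧ HasGramCharFun γ u := by
  set e := gramSchmidtNormed ℝ u with he
  set X : (ℕ → ℝ) → ℕ → ℝ := fun g n => ∑ i ∈ Finset.range (n + 1), inner ℝ (e i) (u n) * g i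
    with hX
  have hXm : Measurable X := by
    refine measurable_pi_lambda _ fun n => ?_
    simp only [hX]
    fun_prop
  refine ⟨(Measure.infinitePi fun _ : ℕ => ProbabilityTheory.gaussianReal 0 1).map X,
    Measure.isProbabilityMeasure_map hXm.aemeasurable, fun s => ?_⟩
  rw [integral_map hXm.aemeasurable
    ((measurable_linearCombination s).complex_ofReal.mul_const _).cexp.aestronglyMeasurable]
  obtain ⟨K, hK⟩ : ∃ K, ∀ n ∈ s.support, n < K :=
    ⟨s.support.sup id + 1, fun n hn => Nat.lt_succ_of_le (Finset.le_sup (f := id) hn)⟩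
  set w := Finsupp.linearCombination ℝ u s with hw
  have hwmem : w ∈ Submodule.span ℝ (u '' Set.Iio K) := by
    rw [hw, Finsupp.linearCombination_apply]
    exact Submodule.sum_mem _ fun n hn => Submodule.smul_mem _ _
      (Submodule.subset_span ⟨n, hK n hn, rfl⟩)
  have hsum : ∀ g, Finsupp.linearCombination ℝ (X g) s =
      ∑ i ∈ Finset.range K, inner ℝ (e i) w * g i := by
    intro g
    have hXK : ∀ n ∈ s.support, X g n = ∑ i ∈ Finset.range K, inner ℝ (e i) (u n) * g i := by
      intro n hn
      refine Finset.sum_subset (Finset.range_mono (hK n hn)) fun i _ hi => ?_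
      have : inner ℝ (e i) (u n) = 0 := by
        rw [he, gramSchmidtNormed, inner_smul_left, gramSchmidt_inv_triangular]
        · simp
        · simpa using hi
      simp [this]
    rw [Finsupp.linearCombination_apply, Finsupp.sum, Finset.sum_congr rfl fun n hn => by
      rw [hXK n hn], hw, Finsupp.linearCombination_apply, Finsupp.sum]
    simp only [smul_eq_mul, inner_sum, inner_smul_right, Finset.mul_sum, Finset.sum_mul]
    rw [Finset.sum_comm]
    simp only [mul_assoc]
  simp_rw [hsum]
  rw [integral_exp_sum_gaussian, sum_inner_gramSchmidtNormed_sq u K hwmem]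

/-- Existence of centred Gaussian families with prescribed covariances. -/
lemma exists_hasGramCharFun {ι : Type*} (e : ι ≃ ℕ) (v : ι → H) :
    ∃ γ : Measure (ι → ℝ), IsProbabilityMeasure γ ∧ HasGramCharFun γ v := by
  obtain ⟨γ, _, hγ⟩ := exists_hasGramCharFun_nat (v ∘ e.symm)
  have hm : Measurable fun (x : ℕ → ℝ) (i : ι) => x (e i) := by fun_prop
  refine ⟨γ.map fun x i => x (e i), Measure.isProbabilityMeasure_map hm.aemeasurable,
    fun s => ?_⟩
  rw [integral_map hm.aemeasurable
    ((measurable_linearCombination s).complex_ofReal.mul_const _).cexp.aestronglyMeasurable]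
  have := hγ (s.mapDomain e)
  simp only [Finsupp.linearCombination_mapDomain, Function.comp_assoc, Equiv.symm_comp_self,
    Function.comp_id] at this
  exact this

end GramSchmidt

section WeakConvergence

variable {E : Type*} [NormedAddCommGroup E] [InnerProductSpace ℂ E]

lemma tendsto_inner_zero_of_dense_span {D : Set E}
    (hD : (Submodule.span ℂ D).topologicalClosure = ⊤) {y : ℕ → E} {C : ℝ}
    (hy : ∀ k, ‖y k‖ ≤ C) (h : ∀ g ∈ D, Tendsto (fun k => inner ℂ (y k) g) atTop (𝓝 0))
    (g : E) : Tendsto (fun k => inner ℂ (y k) g) atTop (𝓝 0) := by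
  have hspan : ∀ g ∈ Submodule.span ℂ D, Tendsto (fun k => inner ℂ (y k) g) atTop (𝓝 0) := by
    intro g hg
    induction hg using Submodule.span_induction with
    | mem x hx => exact h x hx
    | zero => simp
    | add x z _ _ hx hz => simpa [inner_add_right] using hx.add hz
    | smul a x _ hx => simpa [inner_smul_right] using hx.const_mul a
  have hC : 0 ≤ C := (norm_nonneg _).trans (hy 0)
  have hg : g ∈ closure (Submodule.span ℂ D : Set E) := by
    rw [← Submodule.topologicalClosure_coe, hD]
    trivial
  rw [Metric.tendsto_atTop]
  intro ε hε
  obtain ⟨g', hg', hgg'⟩ := Metric.mem_closure_iff.1 hg (ε / (2 * (C + 1))) (by positivity)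
  obtain ⟨n, hn⟩ := Metric.tendsto_atTop.1 (hspan g' hg') (ε / 2) (by positivity)
  refine ⟨n, fun k hk => ?_⟩
  have h1 := hn k hk
  rw [dist_zero_right] at h1 ⊢
  have h2 : ‖inner ℂ (y k) (g - g')‖ ≤ ε / 2 := by
    calc ‖inner ℂ (y k) (g - g')‖ ≤ ‖y k‖ * ‖g - g'‖ := norm_inner_le_norm _ _
      _ ≤ (C + 1) * (ε / (2 * (C + 1))) := by
          rw [← dist_eq_norm]
          gcongr
          linarith [hy k]
      _ = ε / 2 := by field_simp
  calc ‖inner ℂ (y k) g‖ = ‖inner ℂ (y k) (g - g') + inner ℂ (y k) g'‖ := by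
        rw [← inner_add_right, sub_add_cancel]
    _ ≤ ‖inner ℂ (y k) (g - g')‖ + ‖inner ℂ (y k) g'‖ := norm_add_le _ _
    _ < ε := by linarith

lemma tendsto_inner_of_dense_span [CompleteSpace E] {D : Set E}
    (hD : (Submodule.span ℂ D).topologicalClosure = ⊤) {U : ℕ → E →L[ℂ] E} {V : E →L[ℂ] E}
    {C : ℝ} (hU : ∀ k, ‖U k‖ ≤ C)
    (h : ∀ f ∈ D, ∀ g ∈ D, Tendsto (fun k => inner ℂ f (U k g)) atTop (𝓝 (inner ℂ f (V g))))
    (f g : E) : Tendsto (fun k => inner ℂ f (U k g)) atTop (𝓝 (inner ℂ f (V g))) := by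
  have hW : ∀ k, ‖U k - V‖ ≤ C + ‖V‖ := fun k =>
    (norm_sub_le _ _).trans (add_le_add_left (hU k) _)
  have h0 : ∀ f g : E, Tendsto (fun k => inner ℂ f (U k g)) atTop (𝓝 (inner ℂ f (V g))) ↔
      Tendsto (fun k => inner ℂ f ((U k - V) g)) atTop (𝓝 0) := by
    intro f g
    rw [← tendsto_sub_nhds_zero_iff]
    simp
  have h1 : ∀ f ∈ D, ∀ g, Tendsto (fun k => inner ℂ f ((U k - V) g)) atTop (𝓝 0) := by
    intro f hf g
    have := tendsto_inner_zero_of_dense_span hD (y := fun k => (U k - V).adjoint f)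
      (C := (C + ‖V‖) * ‖f‖) (fun k => ?_) (fun g hg => ?_) g
    · simpa only [ContinuousLinearMap.adjoint_inner_left] using this
    · refine (ContinuousLinearMap.le_opNorm _ _).trans ?_
      rw [LinearIsometryEquiv.norm_map]
      gcongr
      exact hW k
    · simp only [ContinuousLinearMap.adjoint_inner_left]
      exact (h0 f g).1 (h f hf g hg)
  rw [h0]
  have := tendsto_inner_zero_of_dense_span hD (y := fun k => (U k - V) g)
      (C := (C + ‖V‖) * ‖g‖) (fun k => ?_) (fun f hf => ?_) f
  · have h2 := (Complex.continuous_conj.tendsto 0).comp this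
    rw [map_zero] at h2
    refine h2.congr fun k => ?_
    exact inner_conj_symm f _
  · refine (ContinuousLinearMap.le_opNorm _ _).trans ?_
    gcongr
    exact hW k
  · have h2 := (Complex.continuous_conj.tendsto 0).comp (h1 f hf g)
    rw [map_zero] at h2
    refine h2.congr fun k => ?_
    exact inner_conj_symm _ f

end WeakConvergence

section TrigDense

variable {ι : Type*} (γ : Measure (ι → ℝ))

/-- The function `x ↦ exp (i ∑ s j * x j)`. -/
def expLin (s : ι →₀ ℝ) (x : ι → ℝ) : ℂ :=
  Complex.exp ((Finsupp.linearCombination ℝ x s : ℝ) * Complex.I)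

lemma measurable_expLin (s : ι →₀ ℝ) : Measurable (expLin s) :=
  ((measurable_linearCombination s).complex_ofReal.mul_const _).cexp

lemma norm_expLin (s : ι →₀ ℝ) (x : ι → ℝ) : ‖expLin s x‖ = 1 :=
  Complex.norm_exp_ofReal_mul_I _

lemma conj_expLin (s : ι →₀ ℝ) (x : ι → ℝ) :
    (starRingEnd ℂ) (expLin s x) = expLin (-s) x := by
  simp [expLin, ← Complex.exp_conj]

lemma expLin_add (s t : ι →₀ ℝ) (x : ι → ℝ) : expLin (s + t) x = expLin s x * expLin t x := by
  simp [expLin, ← Complex.exp_add, add_mul]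

lemma memLp_expLin [IsFiniteMeasure γ] (s : ι →₀ ℝ) : MemLp (expLin s) 2 γ :=
  MemLp.of_bound (measurable_expLin s).aestronglyMeasurable 1
    (Eventually.of_forall fun x => (norm_expLin s x).le)

variable [Countable ι]

lemma ae_eq_zero_of_integral_expLin_mul_real {r : (ι → ℝ) → ℝ} (hr : Integrable r γ)
    (h : ∀ s, ∫ x, expLin s x * r x ∂γ = 0) : r =ᵐ[γ] 0 := by
  have hint : ∀ (r : (ι → ℝ) → ℝ), Integrable r γ →
      IsFiniteMeasure (γ.withDensity fun x => ENNReal.ofReal (r x)) := fun r hr =>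
    isFiniteMeasure_withDensity_ofReal hr.2
  have hdens : ∀ (r : (ι → ℝ) → ℝ), Integrable r γ → ∀ s,
      ∫ x, expLin s x ∂(γ.withDensity fun x => ENNReal.ofReal (r x)) =
        ∫ x, expLin s x * (max (r x) 0 : ℝ) ∂γ := by
    intro r hr s
    rw [integral_withDensity_eq_integral_toReal_smul₀ hr.1.aemeasurable.ennreal_ofReal
      (Eventually.of_forall fun _ => ENNReal.ofReal_lt_top)]
    refine integral_congr_ae (Eventually.of_forall fun x => ?_)
    simp only [ENNReal.toReal_ofReal', Complex.real_smul]
    ring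
  have hi : ∀ (r : (ι → ℝ) → ℝ), Integrable r γ → ∀ s,
      Integrable (fun x => expLin s x * (max (r x) 0 : ℝ)) γ := by
    intro r hr s
    exact (hr.pos_part.ofReal (𝕜 := ℂ)).bdd_mul (c := 1)
      (measurable_expLin s).aestronglyMeasurable
      (Eventually.of_forall fun x => (norm_expLin s x).le)
  have := hint r hr
  have := hint (-r) hr.neg
  have hμ : (γ.withDensity fun x => ENNReal.ofReal (r x)) =
      γ.withDensity fun x => ENNReal.ofReal ((-r) x) := by
    refine measure_ext_of_linearCombination fun s => ?_
    refine (hdens r hr s).trans (Eq.trans ?_ (hdens (-r) hr.neg s).symm)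
    rw [← sub_eq_zero, ← integral_sub (hi r hr s) (hi (-r) hr.neg s), ← h s]
    refine integral_congr_ae (Eventually.of_forall fun x => ?_)
    simp only [← mul_sub, Pi.neg_apply, ← Complex.ofReal_sub]
    rw [max_zero_sub_max_neg_zero_eq_self]
  refine hr.ae_eq_zero_of_forall_setIntegral_eq_zero fun A hA _ => ?_
  rw [integral_eq_lintegral_pos_part_sub_lintegral_neg_part hr.integrableOn,
    ← withDensity_apply _ hA, hμ, withDensity_apply _ hA]
  simp

lemma ae_eq_zero_of_integral_expLin_mul {r : (ι → ℝ) → ℂ} (hr : Integrable r γ)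
    (h : ∀ s, ∫ x, expLin s x * r x ∂γ = 0) : r =ᵐ[γ] 0 := by
  have hi : ∀ (r : (ι → ℝ) → ℂ), Integrable r γ → ∀ s,
      Integrable (fun x => expLin s x * r x) γ := fun r hr s =>
    hr.bdd_mul (c := 1) (measurable_expLin s).aestronglyMeasurable
      (Eventually.of_forall fun x => (norm_expLin s x).le)
  have hc : Integrable (fun x => (starRingEnd ℂ) (r x)) γ :=
    (Complex.conjLIE.integrable_comp_iff).2 hr
  have hconj : ∀ s, ∫ x, expLin s x * (starRingEnd ℂ) (r x) ∂γ = 0 := by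
    intro s
    have := congrArg (starRingEnd ℂ) (h (-s))
    rw [← integral_conj] at this
    simpa [conj_expLin] using this
  have hre := ae_eq_zero_of_integral_expLin_mul_real γ hr.re fun s => by
    have : ∀ x, expLin s x * ((RCLike.re (r x) : ℝ) : ℂ) =
        (1 / 2 : ℂ) * (expLin s x * r x + expLin s x * (starRingEnd ℂ) (r x)) := by
      intro x
      rw [← mul_add, Complex.add_conj]
      simp
      ring
    simp_rw [this]
    rw [integral_const_mul, integral_add (hi r hr s) (hi _ hc s), h, hconj]
    simp
  have him := ae_eq_zero_of_integral_expLin_mul_real γ hr.im fun s => by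
    have : ∀ x, expLin s x * ((RCLike.im (r x) : ℝ) : ℂ) =
        (-Complex.I / 2 : ℂ) * (expLin s x * r x - expLin s x * (starRingEnd ℂ) (r x)) := by
      intro x
      rw [← mul_sub, Complex.sub_conj]
      simp only [RCLike.im_to_complex]
      push_cast
      linear_combination (expLin s x * (r x).im) * Complex.I_sq
    simp_rw [this]
    rw [integral_const_mul, integral_sub (hi r hr s) (hi _ hc s), h, hconj]
    simp
  filter_upwards [hre, him] with x h1 h2
  exact Complex.ext h1 h2

lemma dense_span_expLin [IsFiniteMeasure γ] :
    (Submodule.span ℂ (Set.range fun s : ι →₀ ℝ =>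
      (memLp_expLin γ s).toLp (expLin s))).topologicalClosure = ⊤ := by
  rw [Submodule.topologicalClosure_eq_top_iff, Submodule.eq_bot_iff]
  intro h hh
  rw [Lp.eq_zero_iff_ae_eq_zero]
  refine ae_eq_zero_of_integral_expLin_mul γ
    ((Lp.memLp h).integrable one_le_two) fun s => ?_
  have := (Submodule.mem_orthogonal _ _).1 hh _ (Submodule.subset_span ⟨-s, rfl⟩)
  rw [L2.inner_def] at this
  rw [← this]
  refine integral_congr_ae ?_
  filter_upwards [(memLp_expLin γ (-s)).coeFn_toLp] with x hx
  rw [hx, RCLike.inner_apply, conj_expLin, neg_neg, mul_comm]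

end TrigDense

section Shift

/-- Translation by `m` on `ℤ → ℝ`. -/
def shift (m : ℤ) (x : ℤ → ℝ) : ℤ → ℝ := fun n => x (n + m)

lemma measurable_shift (m : ℤ) : Measurable (shift m) := by
  unfold shift
  fun_prop

/-- Translation by `m` of the coefficients of a linear form on `ℤ → ℝ`. -/
def shiftCoeff (m : ℤ) (s : ℤ →₀ ℝ) : ℤ →₀ ℝ := s.mapDomain (· + m)

lemma linearCombination_shiftCoeff {M : Type*} [AddCommGroup M] [Module ℝ M] (v : ℤ → M)
    (m : ℤ) (s : ℤ →₀ ℝ) :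
    Finsupp.linearCombination ℝ v (shiftCoeff m s) =
      Finsupp.linearCombination ℝ (fun n => v (n + m)) s :=
  Finsupp.linearCombination_mapDomain ..

lemma expLin_shift (m : ℤ) (s : ℤ →₀ ℝ) (x : ℤ → ℝ) :
    expLin s (shift m x) = expLin (shiftCoeff m s) x := by
  rw [expLin, expLin, linearCombination_shiftCoeff]
  rfl

variable {H : Type*} [NormedAddCommGroup H] [InnerProductSpace ℝ H] {v : ℤ → H} {c : ℤ → ℝ}

lemma inner_linearCombination (v w : ℤ → H) (s t : ℤ →₀ ℝ) :
    inner ℝ (Finsupp.linearCombination ℝ v s) (Finsupp.linearCombination ℝ w t) =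
      ∑ i ∈ s.support, ∑ j ∈ t.support, s i * (t j * inner ℝ (v i) (w j)) := by
  simp only [Finsupp.linearCombination_apply, Finsupp.sum, sum_inner, inner_sum,
    inner_smul_left, inner_smul_right, RCLike.conj_to_real, Finset.mul_sum]
  rw [Finset.sum_comm]
  exact Finset.sum_congr rfl fun i _ => Finset.sum_congr rfl fun j _ => by ring

lemma norm_linearCombination_shiftCoeff (hv : ∀ i j, inner ℝ (v i) (v j) = c (j - i))
    (m : ℤ) (s : ℤ →₀ ℝ) :
    ‖Finsupp.linearCombination ℝ v (shiftCoeff m s)‖ ^ 2 =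
      ‖Finsupp.linearCombination ℝ v s‖ ^ 2 := by
  simp only [← real_inner_self_eq_norm_sq, linearCombination_shiftCoeff, inner_linearCombination,
    hv, add_sub_add_right_eq_sub]

variable {γ : Measure (ℤ → ℝ)}

lemma HasGramCharFun.integral_expLin (hγ : HasGramCharFun γ v) (s : ℤ →₀ ℝ) :
    ∫ x, expLin s x ∂γ =
      Complex.exp (-(‖Finsupp.linearCombination ℝ v s‖ ^ 2 / 2 : ℝ)) := hγ s

variable [IsProbabilityMeasure γ]

lemma HasGramCharFun.measurePreserving_shift (hγ : HasGramCharFun γ v)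
    (hv : ∀ i j, inner ℝ (v i) (v j) = c (j - i)) (m : ℤ) :
    MeasurePreserving (shift m) γ γ := by
  refine ⟨measurable_shift m, ?_⟩
  have := Measure.isProbabilityMeasure_map (μ := γ) (measurable_shift m).aemeasurable
  refine measure_ext_of_linearCombination fun s => ?_
  change ∫ x, expLin s x ∂(γ.map (shift m)) = ∫ x, expLin s x ∂γ
  rw [integral_map (measurable_shift m).aemeasurable
    (measurable_expLin s).aestronglyMeasurable]
  simp_rw [expLin_shift]
  rw [hγ.integral_expLin, hγ.integral_expLin, norm_linearCombination_shiftCoeff hv]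

lemma HasGramCharFun.inner_expLin (hγ : HasGramCharFun γ v) (s t : ℤ →₀ ℝ) :
    inner ℂ ((memLp_expLin γ s).toLp (expLin s)) ((memLp_expLin γ t).toLp (expLin t)) =
      Complex.exp (-((‖Finsupp.linearCombination ℝ v s‖ ^ 2 +
        ‖Finsupp.linearCombination ℝ v t‖ ^ 2 - 2 * inner ℝ (Finsupp.linearCombination ℝ v s)
          (Finsupp.linearCombination ℝ v t)) / 2 : ℝ)) := by
  rw [L2.inner_def]
  have : ∀ᵐ x ∂γ, inner ℂ ((memLp_expLin γ s).toLp (expLin s) x)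
      ((memLp_expLin γ t).toLp (expLin t) x) = expLin (t - s) x := by
    filter_upwards [(memLp_expLin γ s).coeFn_toLp, (memLp_expLin γ t).coeFn_toLp] with x h1 h2
    rw [h1, h2, RCLike.inner_apply, conj_expLin, sub_eq_add_neg, expLin_add]
  rw [integral_congr_ae this, hγ.integral_expLin, map_sub, norm_sub_sq_real,
    real_inner_comm]
  congr 4
  ring

lemma HasGramCharFun.inner_expLin_shift (hγ : HasGramCharFun γ v)
    (hv : ∀ i j, inner ℝ (v i) (v j) = c (j - i)) (m : ℤ) (s t : ℤ →₀ ℝ) :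
    inner ℂ ((memLp_expLin γ s).toLp (expLin s))
      (Lp.compMeasurePreservingₗᵢ ℂ (shift m) (hγ.measurePreserving_shift hv m)
        ((memLp_expLin γ t).toLp (expLin t))) =
      Complex.exp (-((‖Finsupp.linearCombination ℝ v s‖ ^ 2 +
        ‖Finsupp.linearCombination ℝ v t‖ ^ 2 -
          2 * ∑ i ∈ s.support, ∑ j ∈ t.support, s i * (t j * c (m + (j - i)))) / 2 : ℝ)) := by
  have h1 : Lp.compMeasurePreservingₗᵢ ℂ (shift m) (hγ.measurePreserving_shift hv m)
      ((memLp_expLin γ t).toLp (expLin t)) =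
        (memLp_expLin γ (shiftCoeff m t)).toLp (expLin (shiftCoeff m t)) := by
    refine (Lp.toLp_compMeasurePreserving (memLp_expLin γ t)
      (hγ.measurePreserving_shift hv m)).trans ?_
    congr 1
    exact funext fun x => expLin_shift m t x
  rw [h1, hγ.inner_expLin, norm_linearCombination_shiftCoeff hv, linearCombination_shiftCoeff,
    inner_linearCombination]
  simp only [hv]
  have h2 : ∀ i j : ℤ, j + m - i = m + (j - i) := fun i j => by ring
  simp only [h2]

/-- If the correlations along `a k` converge on exponentials, then they converge on sets. -/
lemma HasGramCharFun.tendsto_measure_of_tendsto (hγ : HasGramCharFun γ v)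
    (hv : ∀ i j, inner ℝ (v i) (v j) = c (j - i)) {a : ℕ → ℤ} {c' : ℤ → ℝ}
    (ha : ∀ d, Tendsto (fun k => c (a k + d)) atTop (𝓝 (c' d)))
    {V : Lp ℂ 2 γ →L[ℂ] Lp ℂ 2 γ}
    (hV : ∀ s t : ℤ →₀ ℝ, inner ℂ ((memLp_expLin γ s).toLp (expLin s))
      (V ((memLp_expLin γ t).toLp (expLin t))) =
      Complex.exp (-((‖Finsupp.linearCombination ℝ v s‖ ^ 2 +
        ‖Finsupp.linearCombination ℝ v t‖ ^ 2 -
          2 * ∑ i ∈ s.support, ∑ j ∈ t.support, s i * (t j * c' (j - i))) / 2 : ℝ)))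
    {A B : Set (ℤ → ℝ)} (hA : MeasurableSet A) (hB : MeasurableSet B) :
    Tendsto (fun k => (γ.real (A ∩ shift (a k) ⁻¹' B) : ℂ)) atTop
      (𝓝 (inner ℂ (indicatorConstLp 2 hA (measure_ne_top γ A) (1 : ℂ))
        (V (indicatorConstLp 2 hB (measure_ne_top γ B) (1 : ℂ))))) := by
  have key := tendsto_inner_of_dense_span (dense_span_expLin γ)
    (U := fun k => (Lp.compMeasurePreservingₗᵢ ℂ (shift (a k))
      (hγ.measurePreserving_shift hv (a k))).toContinuousLinearMap) (V := V) (C := 1)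
    (fun k => LinearIsometry.norm_toContinuousLinearMap_le _) ?_
    (indicatorConstLp 2 hA (measure_ne_top γ A) (1 : ℂ))
    (indicatorConstLp 2 hB (measure_ne_top γ B) (1 : ℂ))
  · refine key.congr fun k => ?_
    have h1 : (Lp.compMeasurePreservingₗᵢ ℂ (shift (a k))
      (hγ.measurePreserving_shift hv (a k))).toContinuousLinearMap
        (indicatorConstLp 2 hB (measure_ne_top γ B) (1 : ℂ)) =
        indicatorConstLp 2 (measurable_shift (a k) hB) (measure_ne_top γ _) (1 : ℂ) :=
      Lp.indicatorConstLp_compMeasurePreserving hB _ _ _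
    rw [h1]
    exact L2.inner_indicatorConstLp_one_indicatorConstLp_one hA (measurable_shift (a k) hB)
  · rintro _ ⟨s, rfl⟩ _ ⟨t, rfl⟩
    simp only [LinearIsometry.coe_toContinuousLinearMap, hγ.inner_expLin_shift hv, hV]
    refine (Complex.continuous_exp.tendsto _).comp ?_
    refine (Tendsto.neg ?_)
    refine (Complex.continuous_ofReal.tendsto _).comp ?_
    refine Tendsto.div_const (tendsto_const_nhds.sub (Tendsto.const_mul _ ?_)) _
    exact tendsto_finsetSum _ fun i _ => tendsto_finsetSum _ fun j _ =>
      ((ha _).const_mul _).const_mul _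

lemma HasGramCharFun.tendsto_rigid (hγ : HasGramCharFun γ v)
    (hv : ∀ i j, inner ℝ (v i) (v j) = c (j - i)) {a : ℕ → ℤ}
    (ha : ∀ d, Tendsto (fun k => c (a k + d)) atTop (𝓝 (c d)))
    {A B : Set (ℤ → ℝ)} (hA : MeasurableSet A) (hB : MeasurableSet B) :
    Tendsto (fun k => γ.real (A ∩ shift (a k) ⁻¹' B)) atTop (𝓝 (γ.real (A ∩ B))) := by
  have := hγ.tendsto_measure_of_tendsto hv ha (V := ContinuousLinearMap.id ℂ _)
    (fun s t => by
      rw [ContinuousLinearMap.id_apply, hγ.inner_expLin, inner_linearCombination]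
      simp only [hv]) hA hB
  rw [ContinuousLinearMap.id_apply,
    L2.inner_indicatorConstLp_one_indicatorConstLp_one hA hB] at this
  exact_mod_cast (Complex.continuous_re.tendsto _).comp this

lemma HasGramCharFun.tendsto_mixing (hγ : HasGramCharFun γ v)
    (hv : ∀ i j, inner ℝ (v i) (v j) = c (j - i)) {a : ℕ → ℤ}
    (ha : ∀ d, Tendsto (fun k => c (a k + d)) atTop (𝓝 0))
    {A B : Set (ℤ → ℝ)} (hA : MeasurableSet A) (hB : MeasurableSet B) :
    Tendsto (fun k => γ.real (A ∩ shift (a k) ⁻¹' B)) atTop (𝓝 (γ.real A * γ.real B)) := by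
  set e : Lp ℂ 2 γ := indicatorConstLp 2 MeasurableSet.univ (measure_ne_top γ _) (1 : ℂ) with he
  have he' : e = (memLp_expLin γ 0).toLp (expLin 0) := by
    rw [he, indicatorConstLp]
    congr 1
    ext x
    simp [expLin]
  have := hγ.tendsto_measure_of_tendsto hv ha (c' := 0)
    (V := (innerSL ℂ e).smulRight e)
    (fun s t => by
      rw [ContinuousLinearMap.smulRight_apply, inner_smul_right, innerSL_apply_apply, he',
        hγ.inner_expLin, hγ.inner_expLin, ← Complex.exp_add]
      congr 1
      simp
      ring) hA hB
  rw [ContinuousLinearMap.smulRight_apply, inner_smul_right, innerSL_apply_apply, he,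
    L2.inner_indicatorConstLp_one_indicatorConstLp_one MeasurableSet.univ hB,
    L2.inner_indicatorConstLp_one_indicatorConstLp_one hA MeasurableSet.univ] at this
  simp only [Set.univ_inter, Set.inter_univ] at this
  rw [mul_comm]
  exact_mod_cast (Complex.continuous_re.tendsto _).comp this

open ProbabilityTheory in
lemma HasGramCharFun.nullSingletonClass (hγ : HasGramCharFun γ v) (h0 : ‖v 0‖ = 1) :
    NullSingletonClass γ := by
  have hm : Measurable fun x : ℤ → ℝ => x 0 := by fun_prop
  have hlaw : γ.map (fun x => x 0) = gaussianReal 0 1 := by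
    have := Measure.isProbabilityMeasure_map (μ := γ) hm.aemeasurable
    refine Measure.ext_of_charFun (funext fun t => ?_)
    rw [charFun_gaussianReal, charFun_apply_real, integral_map hm.aemeasurable (by fun_prop)]
    have := hγ (Finsupp.single 0 t)
    simp only [Finsupp.linearCombination_single, norm_smul, h0, smul_eq_mul,
      Complex.ofReal_mul] at this
    rw [this]
    simp
  refine ⟨fun x => measure_mono_null (t := (fun x : ℤ → ℝ => x 0) ⁻¹' {x 0})
    (by simp) ?_⟩
  rw [← Measure.map_apply hm (measurableSet_singleton _), hlaw]
  have := nullSingletonClass_gaussianReal (μ := 0) (v := 1) one_ne_zero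
  exact measure_singleton _

end Shift

section WeakMixing

lemma norm_sq_sum_le_of_abs_inner_le {H : Type*} [NormedAddCommGroup H] [InnerProductSpace ℝ H]
    {ε : ℝ} {h : ℕ → H} (h1 : ∀ i, ‖h i‖ ≤ 1) (hε : ∀ i j, i < j → |inner ℝ (h i) (h j)| ≤ ε)
    (hε0 : 0 ≤ ε) (L : ℕ) {σ : ℕ → ℝ} (hσ : ∀ i, |σ i| ≤ 1) :
    ‖∑ i ∈ Finset.range L, σ i • h i‖ ^ 2 ≤ L + L ^ 2 * ε := by
  have key : ∀ i j, σ i * (σ j * inner ℝ (h i) (h j)) ≤ (if i = j then 1 else 0) + ε := by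
    intro i j
    have hle : σ i * (σ j * inner ℝ (h i) (h j)) ≤ |inner ℝ (h i) (h j)| := by
      refine (le_abs_self _).trans ?_
      rw [abs_mul, abs_mul]
      calc |σ i| * (|σ j| * |inner ℝ (h i) (h j)|) ≤ 1 * (1 * |inner ℝ (h i) (h j)|) := by
            gcongr <;> apply hσ
        _ = _ := by ring
    refine hle.trans ?_
    rcases lt_trichotomy i j with hij | rfl | hij
    · simpa [hij.ne] using hε i j hij
    · have := abs_real_inner_le_norm (h i) (h i)
      have h2 := h1 i
      have : |inner ℝ (h i) (h i)| ≤ 1 := by nlinarith [norm_nonneg (h i)]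
      simp only [if_true]
      linarith
    · rw [real_inner_comm]
      simpa [hij.ne'] using hε j i hij
  rw [← real_inner_self_eq_norm_sq, sum_inner]
  calc ∑ i ∈ Finset.range L, inner ℝ (σ i • h i) (∑ j ∈ Finset.range L, σ j • h j)
      = ∑ i ∈ Finset.range L, ∑ j ∈ Finset.range L, σ i * (σ j * inner ℝ (h i) (h j)) := by
        refine Finset.sum_congr rfl fun i _ => ?_
        rw [inner_sum]
        refine Finset.sum_congr rfl fun j _ => ?_
        rw [real_inner_smul_left, real_inner_smul_right]
    _ ≤ ∑ i ∈ Finset.range L, ∑ j ∈ Finset.range L, ((if i = j then 1 else 0) + ε) :=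
        Finset.sum_le_sum fun i _ => Finset.sum_le_sum fun j _ => key i j
    _ = L + L ^ 2 * ε := by
        have : ∀ i ∈ Finset.range L,
            ∑ j ∈ Finset.range L, ((if i = j then (1 : ℝ) else 0) + ε) = 1 + L * ε := by
          intro i hi
          rw [Finset.sum_add_distrib, Finset.sum_ite_eq, if_pos hi]
          simp
        rw [Finset.sum_congr rfl this]
        simp
        ring

lemma sum_abs_inner_le_of_abs_inner_le {H : Type*} [NormedAddCommGroup H] [InnerProductSpace ℝ H]
    {ε : ℝ} {h : ℕ → H} (h1 : ∀ i, ‖h i‖ ≤ 1) (hε : ∀ i j, i < j → |inner ℝ (h i) (h j)| ≤ ε)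
    (hε0 : 0 ≤ ε) (L : ℕ) (f : H) :
    ∑ i ∈ Finset.range L, |inner ℝ f (h i)| ≤ ‖f‖ * √(L + L ^ 2 * ε) := by
  let σ : ℕ → ℝ := fun i => (SignType.sign (inner ℝ f (h i)) : ℝ)
  have hσ : ∀ i, |σ i| ≤ 1 := by
    intro i
    rcases SignType.trichotomy (SignType.sign (inner ℝ f (h i))) with hs | hs | hs <;>
      simp [σ, hs]
  calc ∑ i ∈ Finset.range L, |inner ℝ f (h i)|
      = inner ℝ f (∑ i ∈ Finset.range L, σ i • h i) := by
        rw [inner_sum]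
        refine Finset.sum_congr rfl fun i _ => ?_
        rw [real_inner_smul_right, sign_mul_self]
    _ ≤ ‖f‖ * ‖∑ i ∈ Finset.range L, σ i • h i‖ := real_inner_le_norm _ _
    _ ≤ ‖f‖ * √(L + L ^ 2 * ε) := by
        gcongr
        exact Real.le_sqrt_of_sq_le (norm_sq_sum_le_of_abs_inner_le h1 hε hε0 L hσ)

lemma sum_Icc_le_sum_Icc_shift {a : ℕ → ℝ} {C : ℝ} (h0 : ∀ n, 0 ≤ a n) (hC : ∀ n, a n ≤ C)
    (M m : ℕ) : ∑ n ∈ Finset.Icc 1 M, a n ≤ ∑ n ∈ Finset.Icc 1 M, a (n + m) + m * C := by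
  induction m with
  | zero => simp
  | succ m ih =>
    have key : ∀ M, ∑ n ∈ Finset.Icc 1 M, a (n + m) + a (M + 1 + m) =
        a (1 + m) + ∑ n ∈ Finset.Icc 1 M, a (n + (m + 1)) := by
      intro M
      induction M with
      | zero => simp
      | succ M ihM =>
        rw [Finset.sum_Icc_succ_top (by omega), Finset.sum_Icc_succ_top (by omega), ihM,
          show M + 1 + (m + 1) = M + 1 + 1 + m by ring]
        ring
    have := key M
    have h1 := h0 (M + 1 + m)
    have h2 := hC (1 + m)
    push_cast
    linarith

/-- If the Gram matrix of a stationary sequence tends to zero along a sequence of gaps, then the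
sequence converges weakly to zero in density. -/
lemma tendsto_cesaro_abs_inner {H : Type*} [NormedAddCommGroup H] [InnerProductSpace ℝ H]
    {g : ℕ → H} {r : ℤ → ℝ} (hr : ∀ i j : ℕ, inner ℝ (g i) (g j) = r ((j : ℤ) - i))
    (h1 : ∀ i, ‖g i‖ ≤ 1) {l : ℕ → ℕ} (hl : ∀ d : ℤ, Tendsto (fun k => r (l k + d)) atTop (𝓝 0))
    (f : H) :
    Tendsto (fun M : ℕ => (1 / (M : ℝ)) * ∑ n ∈ Finset.Icc 1 M, |inner ℝ f (g n)|)
      atTop (𝓝 0) := by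
  have hseq : ∀ ε : ℝ, 0 < ε → ∃ m : ℕ → ℕ, ∀ i j, i < j → |r ((m j : ℤ) - m i)| ≤ ε := by
    intro ε hε
    obtain ⟨m, -, hm⟩ := exists_seq_of_forall_finset_exists (fun _ : ℕ => True)
      (fun x y => |r ((y : ℤ) - x)| ≤ ε) (by
        intro s _
        have : ∀ᶠ k in atTop, ∀ x ∈ s, |r ((l k : ℤ) - x)| ≤ ε := by
          rw [Filter.eventually_all_finset]
          intro x _
          have := (hl (-x)).abs
          rw [abs_zero] at this
          filter_upwards [this.eventually (gt_mem_nhds hε)] with k hk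
          exact hk.le
        obtain ⟨k, hk⟩ := this.exists
        exact ⟨l k, trivial, hk⟩)
    exact ⟨m, hm⟩
  have hbd : ∀ n, |inner ℝ f (g n)| ≤ ‖f‖ := fun n =>
    (abs_real_inner_le_norm _ _).trans (mul_le_of_le_one_right (norm_nonneg f) (h1 n))
  have hfin : ∀ L : ℕ, 0 < L → ∃ K : ℝ, ∀ M : ℕ,
      L * ∑ n ∈ Finset.Icc 1 M, |inner ℝ f (g n)| ≤ M * (‖f‖ * √(2 * L)) + K := by
    intro L hL
    have hL' : (0 : ℝ) < L := by exact_mod_cast hL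
    obtain ⟨m, hm⟩ := hseq (1 / L) (by positivity)
    refine ⟨∑ i ∈ Finset.range L, m i * ‖f‖, fun M => ?_⟩
    have hn : ∀ n, ∑ i ∈ Finset.range L, |inner ℝ f (g (n + m i))| ≤ ‖f‖ * √(2 * L) := by
      intro n
      have := sum_abs_inner_le_of_abs_inner_le (h := fun i => g (n + m i)) (ε := 1 / L)
        (fun i => h1 _) (fun i j hij => by
          rw [hr]
          push_cast
          rw [add_sub_add_left_eq_sub]
          exact hm i j hij) (by positivity) L f
      have h2 : (L : ℝ) + L ^ 2 * (1 / L) = 2 * L := by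
        field_simp
        ring
      rwa [h2] at this
    calc L * ∑ n ∈ Finset.Icc 1 M, |inner ℝ f (g n)|
        = ∑ i ∈ Finset.range L, ∑ n ∈ Finset.Icc 1 M, |inner ℝ f (g n)| := by simp
      _ ≤ ∑ i ∈ Finset.range L,
          (∑ n ∈ Finset.Icc 1 M, |inner ℝ f (g (n + m i))| + m i * ‖f‖) :=
          Finset.sum_le_sum fun i _ => sum_Icc_le_sum_Icc_shift
            (a := fun n => |inner ℝ f (g n)|) (fun n => abs_nonneg _) hbd M (m i)
      _ = ∑ n ∈ Finset.Icc 1 M, ∑ i ∈ Finset.range L, |inner ℝ f (g (n + m i))| +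
          ∑ i ∈ Finset.range L, m i * ‖f‖ := by
          rw [Finset.sum_add_distrib, Finset.sum_comm]
      _ ≤ ∑ n ∈ Finset.Icc 1 M, ‖f‖ * √(2 * L) + ∑ i ∈ Finset.range L, m i * ‖f‖ := by
          gcongr
          exact hn _
      _ = _ := by simp
  have hL : Tendsto (fun L : ℕ => ‖f‖ * √(2 / L)) atTop (𝓝 0) := by
    have h : Tendsto (fun L : ℕ => (2 : ℝ) / L) atTop (𝓝 0) :=
      tendsto_const_nhds.div_atTop tendsto_natCast_atTop_atTop
    simpa using ((Real.continuous_sqrt.tendsto 0).comp h).const_mul ‖f‖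
  rw [Metric.tendsto_atTop']
  intro δ hδ
  obtain ⟨L, hLδ, hL0⟩ := ((hL.eventually (gt_mem_nhds (half_pos hδ))).and
    (eventually_gt_atTop 0)).exists
  obtain ⟨K, hK⟩ := hfin L hL0
  have hM : Tendsto (fun M : ℕ => K / L / (M : ℝ)) atTop (𝓝 0) :=
    tendsto_const_nhds.div_atTop tendsto_natCast_atTop_atTop
  obtain ⟨M₀, hM₀⟩ := (((hM.eventually (gt_mem_nhds (half_pos hδ))).and
    (eventually_gt_atTop 0)).exists_forall_of_atTop)
  refine ⟨M₀, fun M hMM => ?_⟩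
  obtain ⟨hM1, hM2⟩ := hM₀ M hMM.le
  have hM2' : (0 : ℝ) < M := by exact_mod_cast hM2
  have hL0' : (0 : ℝ) < L := by exact_mod_cast hL0
  have hs : 0 ≤ ∑ n ∈ Finset.Icc 1 M, |inner ℝ f (g n)| :=
    Finset.sum_nonneg fun _ _ => abs_nonneg _
  rw [Real.dist_eq, sub_zero, abs_of_nonneg (by positivity)]
  have hsq : √(2 * L) = L * √(2 / L) := by
    rw [show (2 * L : ℝ) = L ^ 2 * (2 / L) by field_simp, Real.sqrt_mul (by positivity),
      Real.sqrt_sq hL0'.le]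
  have h3 : ∑ n ∈ Finset.Icc 1 M, |inner ℝ f (g n)| ≤ M * (‖f‖ * √(2 / L)) + K / L := by
    have := hK M
    rw [hsq] at this
    rw [← mul_le_mul_iff_right₀ hL0']
    refine this.trans_eq ?_
    field_simp
  calc 1 / (M : ℝ) * ∑ n ∈ Finset.Icc 1 M, |inner ℝ f (g n)|
      ≤ 1 / (M : ℝ) * (M * (‖f‖ * √(2 / L)) + K / L) := by gcongr
    _ = ‖f‖ * √(2 / L) + K / L / M := by field_simp
    _ < δ := by linarith

lemma measurePreserving_perm_zpow {X : Type*} [MeasurableSpace X] {γ : Measure X}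
    {S : Equiv.Perm X} (hS : MeasurePreserving S γ γ) (hS' : MeasurePreserving S.symm γ γ)
    (m : ℤ) : MeasurePreserving ⇑(S ^ m) γ γ := by
  have hnat : ∀ n : ℕ, MeasurePreserving ⇑(S ^ n) γ γ := by
    intro n
    rw [Equiv.Perm.coe_pow]
    exact hS.iterate n
  have hinv : ∀ n : ℕ, MeasurePreserving ⇑(S⁻¹ ^ n) γ γ := by
    intro n
    rw [Equiv.Perm.coe_pow]
    exact hS'.iterate n
  cases m with
  | ofNat n => simpa using hnat n
  | negSucc n => simpa only [zpow_negSucc, ← inv_pow] using hinv (n + 1)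

lemma Aut01.measurePreserving_pow (T : Aut01) (m : ℤ) :
    MeasurePreserving ⇑(T.toEquiv ^ m : Equiv.Perm unitInterval)
      (volume : Measure unitInterval) volume :=
  measurePreserving_perm_zpow T.measurePreserving_toFun T.measurePreserving_invFun m

lemma Aut01.corr_preimage (T : Aut01) (m d : ℤ) (A B : Set unitInterval) :
    T.corr m A (⇑(T.toEquiv ^ d : Equiv.Perm unitInterval) ⁻¹' B) = T.corr (m + d) A B := by
  have h : (T.toEquiv ^ (m + d) : Equiv.Perm unitInterval) = T.toEquiv ^ d * T.toEquiv ^ m := by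
    rw [add_comm, zpow_add]
  rw [Aut01.corr, Aut01.corr, h, Equiv.Perm.coe_mul, Set.preimage_comp]

lemma Aut01.measureReal_preimage_inter_preimage (T : Aut01) (i j : ℤ) {A B : Set unitInterval}
    (hA : MeasurableSet A) (hB : MeasurableSet B) :
    volume.real (⇑(T.toEquiv ^ i : Equiv.Perm unitInterval) ⁻¹' A ∩
      ⇑(T.toEquiv ^ j : Equiv.Perm unitInterval) ⁻¹' B) = T.corr (j - i) A B := by
  have h : (T.toEquiv ^ j : Equiv.Perm unitInterval) = T.toEquiv ^ (j - i) * T.toEquiv ^ i := by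
    rw [← zpow_add, sub_add_cancel]
  rw [h, Equiv.Perm.coe_mul, Set.preimage_comp, ← Set.preimage_inter, Measure.real,
    (T.measurePreserving_pow i).measure_preimage
      (hA.inter ((T.measurePreserving_pow (j - i)).measurable hB)).nullMeasurableSet, Aut01.corr]

lemma Aut01.weaklyMixing_of_tendsto (T : Aut01) {l : ℕ → ℕ}
    (h : ∀ E F : Set unitInterval, MeasurableSet E → MeasurableSet F →
      Tendsto (fun k => T.corr (l k) E F) atTop (𝓝 (volume.real E * volume.real F))) :
    T.WeaklyMixing := by
  intro A B hA hB
  have hTB : ∀ n : ℤ, MeasurableSet (⇑(T.toEquiv ^ n : Equiv.Perm unitInterval) ⁻¹' B) :=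
    fun n => (T.measurePreserving_pow n).measurable hB
  have hvol : ∀ n : ℤ, volume.real (⇑(T.toEquiv ^ n : Equiv.Perm unitInterval) ⁻¹' B) =
      volume.real B := fun n => by
    rw [Measure.real, (T.measurePreserving_pow n).measure_preimage hB.nullMeasurableSet,
      Measure.real]
  let ind (S : Set unitInterval) (hS : MeasurableSet S) :
      Lp ℝ 2 (volume : Measure unitInterval) :=
    indicatorConstLp 2 hS (measure_ne_top _ _) 1
  have hind : ∀ S S' hS hS', inner ℝ (ind S hS) (ind S' hS') = volume.real (S ∩ S') :=
    fun S S' hS hS' =>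
      L2.real_inner_indicatorConstLp_one_indicatorConstLp_one hS hS'
        (measure_ne_top _ _) (measure_ne_top _ _)
  let g : ℕ → Lp ℝ 2 (volume : Measure unitInterval) := fun n =>
    ind _ (hTB n) - volume.real B • ind Set.univ MeasurableSet.univ
  have hr : ∀ i j : ℕ, inner ℝ (g i) (g j) =
      (fun n : ℤ => T.corr n B B - volume.real B * volume.real B) ((j : ℤ) - i) := by
    intro i j
    simp only [g, inner_sub_left, inner_sub_right, real_inner_smul_left, real_inner_smul_right,
      hind, Set.inter_univ, Set.univ_inter, hvol, T.measureReal_preimage_inter_preimage _ _ hB hB]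
    simp
  have hg : ∀ i, ‖g i‖ ≤ 1 := by
    intro i
    have h1 := hr i i
    rw [real_inner_self_eq_norm_sq] at h1
    have h2 : T.corr ((i : ℤ) - i) B B ≤ 1 := measureReal_le_one
    have h3 : 0 ≤ volume.real B * volume.real B := by positivity
    simp only at h1
    exact (sq_le_one_iff₀ (norm_nonneg _)).1 (by linarith)
  have hf : ∀ n : ℕ, inner ℝ (ind A hA) (g n) =
      T.corr n A B - volume.real A * volume.real B := by
    intro n
    simp only [g, inner_sub_right, real_inner_smul_right, hind, Set.inter_univ]
    rw [mul_comm]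
    rfl
  have := tendsto_cesaro_abs_inner
    (r := fun n : ℤ => T.corr n B B - volume.real B * volume.real B) hr hg (l := l) (fun d => by
    have := (h B _ hB (hTB d)).sub_const (volume.real B * volume.real B)
    simpa only [T.corr_preimage, hvol, sub_self] using this) (ind A hA)
  simp only [hf] at this
  exact this

end WeakMixing

section Transport

open ProbabilityTheory

lemma continuous_cdf (ν : Measure ℝ) [IsProbabilityMeasure ν] [NullSingletonClass ν] :
    Continuous (cdf ν) := by
  rw [continuous_iff_continuousAt]
  intro x
  rw [(monotone_cdf ν).continuousAt_iff_leftLim_eq_rightLim, (cdf ν).rightLim_eq]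
  have h1 := (cdf ν).measure_singleton x
  rw [measure_cdf, measure_singleton] at h1
  have h2 := (monotone_cdf ν).leftLim_le le_rfl (x := x)
  have h3 := ENNReal.ofReal_eq_zero.1 h1.symm
  linarith

lemma exists_cdf_eq (ν : Measure ℝ) [IsProbabilityMeasure ν] [NullSingletonClass ν] {s : ℝ}
    (h0 : 0 < s) (h1 : s < 1) : ∃ z, cdf ν z = s :=
  mem_range_of_exists_le_of_exists_ge (continuous_cdf ν)
    (((tendsto_cdf_atBot ν).eventually (gt_mem_nhds h0)).exists.imp fun _ h => h.le)
    (((tendsto_cdf_atTop ν).eventually (lt_mem_nhds h1)).exists.imp fun _ h => h.le)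

/-- The cumulative distribution function, as a map to the unit interval. -/
def cdfUnit (ν : Measure ℝ) (z : ℝ) : unitInterval :=
  ⟨cdf ν z, cdf_nonneg ν z, cdf_le_one ν z⟩

lemma monotone_cdfUnit (ν : Measure ℝ) : Monotone (cdfUnit ν) := fun _ _ h => monotone_cdf ν h

lemma measurePreserving_cdfUnit (ν : Measure ℝ) [IsProbabilityMeasure ν] [NullSingletonClass ν] :
    MeasurePreserving (cdfUnit ν) ν volume := by
  refine ⟨(monotone_cdfUnit ν).measurable, ?_⟩
  have := Measure.isProbabilityMeasure_map (μ := ν) (monotone_cdfUnit ν).measurable.aemeasurable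
  refine Measure.ext_of_Iic _ _ fun t => ?_
  rw [unitInterval.volume_Iic, Measure.map_apply (monotone_cdfUnit ν).measurable measurableSet_Iic,
    ← ofReal_measureReal]
  congr 1
  have hsub : ∀ z, cdf ν z ≤ t → Set.Iic z ⊆ cdfUnit ν ⁻¹' Set.Iic t := fun z hz w hw =>
    (monotone_cdfUnit ν hw).trans hz
  have hsup : ∀ z, t < cdf ν z → cdfUnit ν ⁻¹' Set.Iic t ⊆ Set.Iic z := by
    intro z hz w hw
    by_contra hwz
    exact absurd ((monotone_cdf ν (not_le.1 hwz).le).trans hw) (not_le.2 hz)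
  apply le_antisymm
  · refine le_of_forall_gt_imp_ge_of_dense fun s hs => ?_
    rcases lt_or_ge s 1 with h1 | h1
    · obtain ⟨z, rfl⟩ := exists_cdf_eq ν (t.2.1.trans_lt hs) h1
      rw [cdf_eq_real]
      exact measureReal_mono (hsup z hs)
    · exact measureReal_le_one.trans h1
  · refine le_of_forall_lt_imp_le_of_dense fun s hs => ?_
    rcases lt_or_ge 0 s with h0 | h0
    · obtain ⟨z, rfl⟩ := exists_cdf_eq ν h0 (hs.trans_le t.2.2)
      rw [cdf_eq_real]
      exact measureReal_mono (hsub z hs.le)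
    · exact h0.trans measureReal_nonneg

/-- A probability measure without atoms on a standard Borel space is isomorphic to Lebesgue
measure on the unit interval. -/
lemma exists_measurePreserving_injOn {X : Type*} [MeasurableSpace X] [StandardBorelSpace X]
    (γ : Measure X) [IsProbabilityMeasure γ] [NullSingletonClass γ] :
    ∃ (G : X → unitInterval) (R : Set X), MeasurePreserving G γ volume ∧ MeasurableSet R ∧
      (∀ᵐ x ∂γ, x ∈ R) ∧ Set.InjOn G R := by
  have hf := measurableEmbedding_embeddingReal X
  let f := embeddingReal X
  let ν := γ.map f
  have : IsProbabilityMeasure ν := Measure.isProbabilityMeasure_map hf.measurable.aemeasurable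
  have : NullSingletonClass ν := ⟨fun z => by
    rw [Measure.map_apply hf.measurable (measurableSet_singleton z)]
    exact (Set.subsingleton_singleton.preimage hf.injective).measure_zero γ⟩
  have hν := measurePreserving_cdfUnit ν
  let N : Set ℝ := ⋃ r : ℚ, cdfUnit ν ⁻¹' {cdfUnit ν r}
  have hN : MeasurableSet N :=
    MeasurableSet.iUnion fun r => hν.measurable (measurableSet_singleton _)
  have hN0 : ν N = 0 := by
    refine measure_iUnion_null fun r => ?_
    rw [hν.measure_preimage (measurableSet_singleton _).nullMeasurableSet, measure_singleton]
  have hinj : ∀ x y, x ∉ N → x < y → cdfUnit ν x ≠ cdfUnit ν y := by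
    intro x y hx hxy h
    obtain ⟨r, hr1, hr2⟩ := exists_rat_btwn hxy
    exact hx (Set.mem_iUnion.2 ⟨r, le_antisymm (monotone_cdfUnit ν hr1.le)
      ((monotone_cdfUnit ν hr2.le).trans h.ge)⟩)
  refine ⟨cdfUnit ν ∘ f, f ⁻¹' Nᶜ, hν.comp (hf.measurable.measurePreserving γ),
    hf.measurable hN.compl, ?_, ?_⟩
  · rw [ae_iff]
    rw [Measure.map_apply hf.measurable hN] at hN0
    simp only [Set.mem_preimage, Set.mem_compl_iff, not_not]
    exact hN0
  · intro x hx y hy hxy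
    rcases lt_trichotomy (f x) (f y) with h | h | h
    · exact absurd hxy (hinj _ _ hx h)
    · exact hf.injective h
    · exact absurd hxy.symm (hinj _ _ hy h)

lemma measurePreserving_of_semiconj {X Y : Type*} [MeasurableSpace X] [StandardBorelSpace X]
    [MeasurableSpace Y] [StandardBorelSpace Y] {γ : Measure X} {ρ : Measure Y}
    {G : X → Y} (hG : MeasurePreserving G γ ρ) {X₀ : Set X} (hX₀ : MeasurableSet X₀)
    (hae : ∀ᵐ x ∂γ, x ∈ X₀) (hinj : Set.InjOn G X₀) {S : X → X} (hS : MeasurePreserving S γ γ)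
    {T : Y → Y} (hT : ∀ x ∈ X₀, T (G x) = G (S x)) (hT' : ∀ y ∉ G '' X₀, T y = y) :
    MeasurePreserving T ρ ρ := by
  have hY₀ : MeasurableSet (G '' X₀) := hX₀.image_of_measurable_injOn hG.measurable hinj
  have hmeas : Measurable T := by
    intro E hE
    have : T ⁻¹' E = G '' (X₀ ∩ S ⁻¹' (G ⁻¹' E)) ∪ (E ∩ (G '' X₀)ᶜ) := by
      ext y
      by_cases hy : y ∈ G '' X₀
      · obtain ⟨x, hx, rfl⟩ := hy
        have h1 : G x ∈ G '' (X₀ ∩ S ⁻¹' (G ⁻¹' E)) ↔ x ∈ X₀ ∩ S ⁻¹' (G ⁻¹' E) :=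
          hinj.mem_image_iff Set.inter_subset_left hx
        simp only [Set.mem_union, h1]
        simp [hT x hx, hx]
        intro _ h
        exact absurd rfl (h x hx)
      · have h1 : y ∉ G '' (X₀ ∩ S ⁻¹' (G ⁻¹' E)) := fun h =>
          hy (Set.image_mono Set.inter_subset_left h)
        simp only [Set.mem_preimage, Set.mem_union, Set.mem_inter_iff, Set.mem_compl_iff, h1, hy,
          hT' y hy, not_false_eq_true, and_true, false_or]
    rw [this]
    refine MeasurableSet.union ?_ (hE.inter hY₀.compl)
    exact (hX₀.inter (hS.measurable (hG.measurable hE))).image_of_measurable_injOn hG.measurable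
      (hinj.mono Set.inter_subset_left)
  refine ⟨hmeas, ?_⟩
  have h1 : T ∘ G =ᵐ[γ] G ∘ S := by
    filter_upwards [hae] with x hx using hT x hx
  rw [← hG.map_eq, Measure.map_map hmeas hG.measurable, Measure.map_congr h1,
    ← Measure.map_map hG.measurable hS.measurable, hS.map_eq]

/-- An automorphism of a nonatomic standard probability space is realised on the unit interval. -/
lemma exists_aut01_corr_eq {X : Type*} [MeasurableSpace X] [StandardBorelSpace X]
    (γ : Measure X) [IsProbabilityMeasure γ] [NullSingletonClass γ] (S : Equiv.Perm X)
    (hS : MeasurePreserving S γ γ) (hS' : MeasurePreserving S.symm γ γ) :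
    ∃ (T : Aut01) (G : X → unitInterval), MeasurePreserving G γ volume ∧
      ∀ (m : ℤ) (E F : Set unitInterval), MeasurableSet E → MeasurableSet F →
        T.corr m E F = γ.real (G ⁻¹' E ∩ ⇑(S ^ m) ⁻¹' (G ⁻¹' F)) := by
  obtain ⟨G, R, hG, hR, hRae, hRinj⟩ := exists_measurePreserving_injOn γ
  let X₀ : Set X := ⋂ m : ℤ, ⇑(S ^ m) ⁻¹' R
  have hSm := measurePreserving_perm_zpow hS hS'
  have hX₀ : MeasurableSet X₀ := MeasurableSet.iInter fun m => (hSm m).measurable hR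
  have hae : ∀ᵐ x ∂γ, x ∈ X₀ := by
    simp only [X₀, Set.mem_iInter]
    rw [ae_all_iff]
    exact fun m => (hSm m).quasiMeasurePreserving.ae hRae
  have hinj : Set.InjOn G X₀ := hRinj.mono fun x hx => by simpa using Set.mem_iInter.1 hx 0
  have hinv : ∀ x, x ∈ X₀ ↔ S x ∈ X₀ := by
    intro x
    simp only [X₀, Set.mem_iInter, Set.mem_preimage]
    have h : ∀ m : ℤ, (S ^ m) (S x) = (S ^ (m + 1)) x := fun m => by rw [zpow_add_one]; rfl
    simp only [h]
    exact (Equiv.addRight (1 : ℤ)).forall_congr_right.symm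
  let e : X₀ ≃ {y // y ∈ G '' X₀} := Equiv.Set.imageOfInjOn G X₀ hinj
  let S₀ : Equiv.Perm X₀ := S.subtypePerm fun x => (hinv x).symm
  classical
  let T : Equiv.Perm unitInterval := S₀.extendDomain e
  have hTz : ∀ m : ℤ, T ^ m = (S₀ ^ m).extendDomain e := fun m =>
    (map_zpow (Equiv.Perm.extendDomainHom e) S₀ m).symm
  have hT : ∀ (m : ℤ), ∀ x ∈ X₀, (T ^ m) (G x) = G ((S ^ m) x) := by
    intro m x hx
    have h := Equiv.Perm.extendDomain_apply_image (S₀ ^ m) e ⟨x, hx⟩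
    rw [← hTz] at h
    rw [Equiv.Perm.subtypePerm_zpow] at h
    exact h
  have hT' : ∀ (m : ℤ), ∀ y ∉ G '' X₀, (T ^ m) y = y := fun m y hy => by
    rw [hTz]
    exact Equiv.Perm.extendDomain_apply_not_subtype _ _ hy
  have hmp : ∀ m : ℤ, MeasurePreserving ⇑(T ^ m) (volume : Measure unitInterval) volume :=
    fun m => measurePreserving_of_semiconj hG hX₀ hae hinj (hSm m) (hT m) (hT' m)
  refine ⟨⟨T, by simpa using hmp 1, by simpa using hmp (-1)⟩, G, hG, fun m E F hE hF => ?_⟩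
  rw [Aut01.corr, ← hG.measure_preimage
    (hE.inter ((hmp m).measurable hF)).nullMeasurableSet, Measure.real]
  congr 1
  refine measure_congr ?_
  filter_upwards [hae] with x hx
  change (G x ∈ E ∧ (T ^ m) (G x) ∈ F) = (G x ∈ E ∧ G ((S ^ m) x) ∈ F)
  rw [hT m x hx]

end Transport

section Phase

open ProbabilityTheory
open scoped Nat

variable (Q : ℕ)

/-- The `k`-th term of the random phase: the digit `ω k` scaled by `1 / (Q (k+1)!)`. -/
def phaseTerm (k : ℕ) (ω : ℕ → ZMod Q) : ℝ := (ω k).val / (Q * (k + 1)! : ℝ)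

/-- The random phase `∑ ω k / (Q (k+1)!)`. -/
def phase (ω : ℕ → ZMod Q) : ℝ := ∑' k, phaseTerm Q k ω

/-- Independent uniform digits. -/
def phaseMeasure : Measure (ℕ → ZMod Q) := Measure.infinitePi fun _ => uniformOn Set.univ

/-- Increasing the `k`-th digit by one. -/
def phaseStep (k : ℕ) (ω : ℕ → ZMod Q) : ℕ → ZMod Q := fun i => if i = k then ω i + 1 else ω i

/-- The real part of the Fourier coefficients of the law of the random phase. -/
def phaseCoeff (n : ℤ) : ℝ := ∫ ω, Real.cos (2 * Real.pi * n * phase Q ω) ∂phaseMeasure Q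

variable {Q}

lemma phaseTerm_nonneg (k : ℕ) (ω : ℕ → ZMod Q) : 0 ≤ phaseTerm Q k ω := by
  unfold phaseTerm
  positivity

variable [NeZero Q]

lemma isProbabilityMeasure_uniformOn_zmod :
    IsProbabilityMeasure (uniformOn (Set.univ : Set (ZMod Q))) :=
  isProbabilityMeasure_uniformOn Set.finite_univ Set.univ_nonempty

instance : IsProbabilityMeasure (phaseMeasure Q) := by
  have := isProbabilityMeasure_uniformOn_zmod (Q := Q)
  rw [phaseMeasure]
  infer_instance

lemma measurePreserving_add_one_zmod :
    MeasurePreserving (fun x : ZMod Q => x + 1) (uniformOn Set.univ) (uniformOn Set.univ) := by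
  refine ⟨measurable_of_finite _, Measure.ext_of_singleton fun a => ?_⟩
  rw [Measure.map_apply (measurable_of_finite _) (measurableSet_singleton a)]
  have : (fun x : ZMod Q => x + 1) ⁻¹' {a} = {a - 1} := by
    ext x
    exact eq_sub_iff_add_eq.symm
  rw [this, uniformOn_univ, uniformOn_univ, Measure.count_singleton, Measure.count_singleton]

lemma measurePreserving_phaseStep (k : ℕ) :
    MeasurePreserving (phaseStep Q k) (phaseMeasure Q) (phaseMeasure Q) := by
  have := isProbabilityMeasure_uniformOn_zmod (Q := Q)
  refine ⟨?_, ?_⟩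
  · refine measurable_pi_lambda _ fun i => ?_
    exact (measurable_of_finite fun x : ZMod Q => if i = k then x + 1 else x).comp
      (measurable_pi_apply i)
  · have h := Measure.infinitePi_map_pi (μ := fun _ : ℕ => uniformOn (Set.univ : Set (ZMod Q)))
      (f := fun (i : ℕ) (x : ZMod Q) => if i = k then x + 1 else x)
      (fun i => measurable_of_finite _)
    have h2 : ∀ i : ℕ, (uniformOn (Set.univ : Set (ZMod Q))).map
        (fun x : ZMod Q => if i = k then x + 1 else x) = uniformOn Set.univ := by
      intro i
      by_cases hi : i = k
      · simpa [hi] using measurePreserving_add_one_zmod.map_eq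
      · simp [hi]
    simp only [h2] at h
    exact h

lemma phaseTerm_le (k : ℕ) (ω : ℕ → ZMod Q) : phaseTerm Q k ω ≤ 1 / (k + 1)! := by
  have hQ : (0 : ℝ) < Q := by exact_mod_cast NeZero.pos Q
  have h : ((ω k).val : ℝ) ≤ Q := by exact_mod_cast (ZMod.val_lt (ω k)).le
  rw [phaseTerm, div_le_div_iff₀ (by positivity) (by positivity), one_mul]
  gcongr

lemma summable_one_div_factorial_succ : Summable fun k : ℕ => (1 : ℝ) / (k + 1)! := by
  have := (summable_nat_add_iff 1).2 (Real.summable_pow_div_factorial 1)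
  simpa using this

lemma summable_phaseTerm (ω : ℕ → ZMod Q) : Summable fun k => phaseTerm Q k ω :=
  Summable.of_nonneg_of_le (fun k => phaseTerm_nonneg k ω) (fun k => phaseTerm_le k ω)
    summable_one_div_factorial_succ

lemma measurable_phaseTerm (k : ℕ) : Measurable (phaseTerm Q k) :=
  (measurable_of_finite fun x : ZMod Q => (x.val : ℝ) / (Q * (k + 1)! : ℝ)).comp
    (measurable_pi_apply k)

lemma measurable_phase : Measurable (phase Q) := by
  refine measurable_of_tendsto_metrizable
    (f := fun n ω => ∑ k ∈ Finset.range n, phaseTerm Q k ω)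
    (fun n => Finset.measurable_sum _ fun k _ => measurable_phaseTerm k) ?_
  rw [tendsto_pi_nhds]
  exact fun ω => (summable_phaseTerm ω).hasSum.tendsto_sum_nat

lemma exists_int_abs_factorial_mul_phase_sub_le (k : ℕ) (ω : ℕ → ZMod Q) :
    ∃ z : ℤ, |Q * (k + 1)! * phase Q ω - z| ≤ 2 * Q / (k + 2) := by
  have hQ : (0 : ℝ) < Q := by exact_mod_cast NeZero.pos Q
  have hint : ∃ z : ℤ, Q * (k + 1)! * ∑ j ∈ Finset.range (k + 1), phaseTerm Q j ω = z := by
    refine ⟨∑ j ∈ Finset.range (k + 1), (((k + 1)! / (j + 1)! * (ω j).val : ℕ) : ℤ), ?_⟩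
    rw [Finset.mul_sum, Int.cast_sum]
    refine Finset.sum_congr rfl fun j hj => ?_
    have hjk : j + 1 ≤ k + 1 := Finset.mem_range.1 hj
    rw [Int.cast_natCast, Nat.cast_mul, Nat.cast_div (Nat.factorial_dvd_factorial hjk)
      (by positivity), phaseTerm]
    field_simp
  obtain ⟨z, hz⟩ := hint
  refine ⟨z, ?_⟩
  have hs := (summable_nat_add_iff (k + 1)).2 (summable_phaseTerm ω)
  rw [phase, ← (summable_phaseTerm ω).sum_add_tsum_nat_add (k + 1), mul_add, hz,
    add_sub_cancel_left, abs_of_nonneg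
      (mul_nonneg (by positivity) (tsum_nonneg fun j => phaseTerm_nonneg _ ω))]
  have hterm : ∀ j : ℕ, phaseTerm Q (j + (k + 1)) ω ≤
      1 / ((k + 1)! * (k + 2)) * (1 / 2 : ℝ) ^ j := by
    intro j
    refine (phaseTerm_le _ ω).trans ?_
    have h : ((k + 1)! * (k + 2) * 2 ^ j : ℝ) ≤ (j + (k + 1) + 1)! := by
      have h1 : (k + 1)! * (k + 2) ^ (j + 1) ≤ (k + 1 + (j + 1))! :=
        Nat.factorial_mul_pow_le_factorial
      have h2 : (2 : ℕ) ^ j ≤ (k + 2) ^ j := Nat.pow_le_pow_left (by omega) j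
      have h3 : (k + 1)! * (k + 2) * 2 ^ j ≤ (j + (k + 1) + 1)! := by
        calc (k + 1)! * (k + 2) * 2 ^ j ≤ (k + 1)! * (k + 2) * (k + 2) ^ j := by gcongr
          _ = (k + 1)! * (k + 2) ^ (j + 1) := by ring
          _ ≤ (k + 1 + (j + 1))! := h1
          _ = (j + (k + 1) + 1)! := by congr 1; ring
      exact_mod_cast h3
    calc (1 : ℝ) / (j + (k + 1) + 1)! ≤ 1 / ((k + 1)! * (k + 2) * 2 ^ j) := by gcongr
      _ = _ := by
        rw [one_div_pow]
        field_simp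
  have htsum : ∑' j, phaseTerm Q (j + (k + 1)) ω ≤ 1 / ((k + 1)! * (k + 2)) * 2 :=
    hasSum_le hterm hs.hasSum (hasSum_geometric_two.mul_left _)
  calc Q * (k + 1)! * ∑' j, phaseTerm Q (j + (k + 1)) ω
      ≤ Q * (k + 1)! * (1 / ((k + 1)! * (k + 2)) * 2) := by gcongr
    _ = 2 * Q / (k + 2) := by field_simp

lemma exists_val_add_one_eq (hQ : 2 ≤ Q) (x : ZMod Q) :
    ∃ ε : ℝ, (ε = 0 ∨ ε = 1) ∧ ((x + 1).val : ℝ) = x.val + 1 - ε * Q := by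
  have h1 : (1 : ZMod Q).val = 1 := by rw [ZMod.val_one_eq_one_mod, Nat.mod_eq_of_lt hQ]
  have h2 := ZMod.val_lt x
  rw [ZMod.val_add, h1]
  rcases Nat.lt_or_ge (x.val + 1) Q with h | h
  · exact ⟨0, Or.inl rfl, by rw [Nat.mod_eq_of_lt h]; simp⟩
  · have h3 : x.val + 1 = Q := by omega
    refine ⟨1, Or.inr rfl, ?_⟩
    have h4 : (x.val : ℝ) + 1 = Q := by exact_mod_cast h3
    rw [h3, Nat.mod_self, h4]
    simp

lemma exists_phase_phaseStep (hQ : 2 ≤ Q) (k : ℕ) (ω : ℕ → ZMod Q) :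
    ∃ ε : ℝ, (ε = 0 ∨ ε = 1) ∧
      phase Q (phaseStep Q k ω) = phase Q ω + (1 - ε * Q) / (Q * (k + 1)!) := by
  obtain ⟨ε, hε, h⟩ := exists_val_add_one_eq hQ (ω k)
  refine ⟨ε, hε, ?_⟩
  rw [← sub_eq_iff_eq_add', phase, phase,
    ← (summable_phaseTerm _).tsum_sub (summable_phaseTerm ω), tsum_eq_single k]
  · rw [phaseTerm, phaseTerm, ← sub_div, phaseStep, if_pos rfl, h]
    ring
  · intro j hj
    rw [phaseTerm, phaseTerm, phaseStep, if_neg hj, sub_self]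

lemma tendsto_phaseCoeff_of_dvd (m : ℤ) (d : ℤ) :
    Tendsto (fun k : ℕ => phaseCoeff Q (Q * m * (k + 1)! + d)) atTop (𝓝 (phaseCoeff Q d)) := by
  rw [tendsto_iff_dist_tendsto_zero]
  have hlim : Tendsto (fun k : ℕ => 2 * Real.pi * |(m : ℝ)| * (2 * Q) / ((k : ℝ) + 2))
      atTop (𝓝 0) :=
    tendsto_const_nhds.div_atTop (tendsto_atTop_add_const_right _ _ tendsto_natCast_atTop_atTop)
  refine squeeze_zero (fun _ => dist_nonneg) (fun k => ?_) hlim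
  have hint : ∀ n : ℤ, Integrable (fun ω => Real.cos (2 * Real.pi * n * phase Q ω))
      (phaseMeasure Q) := fun n =>
    Integrable.of_bound (C := 1) (Real.measurable_cos.comp
      (measurable_phase.const_mul _)).aestronglyMeasurable
      (Eventually.of_forall fun ω => Real.abs_cos_le_one _)
  rw [Real.dist_eq, phaseCoeff, phaseCoeff, ← integral_sub (hint _) (hint _), ← Real.norm_eq_abs]
  refine (norm_integral_le_of_norm_le_const (Eventually.of_forall fun ω => ?_)).trans_eq
    (by rw [probReal_univ, mul_one])
  obtain ⟨z, hz⟩ := exists_int_abs_factorial_mul_phase_sub_le k ω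
  have h1 : Real.cos (2 * Real.pi * d * phase Q ω) =
      Real.cos (2 * Real.pi * d * phase Q ω + (m * z : ℤ) * (2 * Real.pi)) :=
    (Real.cos_add_int_mul_two_pi _ _).symm
  rw [h1, Real.norm_eq_abs]
  refine (Real.abs_cos_sub_cos_le _ _).trans ?_
  have h2 : 2 * Real.pi * ((Q * m * (k + 1)! + d : ℤ) : ℝ) * phase Q ω -
      (2 * Real.pi * d * phase Q ω + (m * z : ℤ) * (2 * Real.pi)) =
      2 * Real.pi * m * (Q * (k + 1)! * phase Q ω - z) := by
    push_cast
    ring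
  rw [h2, abs_mul, abs_mul, abs_of_pos Real.two_pi_pos, mul_div_assoc]
  gcongr

lemma tendsto_phaseCoeff_of_not_dvd (hQ : 2 ≤ Q) {m : ℤ} (hm : ¬ (Q : ℤ) ∣ m) (d : ℤ) :
    Tendsto (fun k : ℕ => phaseCoeff Q (m * (k + 1)! + d)) atTop (𝓝 0) := by
  have hQ0 : (0 : ℝ) < Q := by exact_mod_cast NeZero.pos Q
  let ζ : ℂ := Complex.exp (Complex.I * (2 * Real.pi * m / Q : ℝ))
  have hζ : ζ ≠ 1 := by
    intro h
    obtain ⟨n, hn⟩ := Complex.exp_eq_one_iff.1 h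
    apply hm
    refine ⟨n, ?_⟩
    have h1 : (2 * Real.pi * m / Q : ℝ) = n * (2 * Real.pi) := by
      have := congrArg Complex.im hn
      simpa using this
    have h2 : (m : ℝ) = Q * n := by
      field_simp at h1
      have hpi := Real.pi_pos
      rw [mul_comm]
      nlinarith [h1]
    exact_mod_cast h2
  let f : ℤ → (ℕ → ZMod Q) → ℂ := fun n ω =>
    Complex.exp (Complex.I * (2 * Real.pi * n * phase Q ω : ℝ))
  have hf : ∀ n, Measurable (f n) := fun n => by
    have := measurable_phase (Q := Q)
    fun_prop
  have hfn : ∀ n ω, ‖f n ω‖ = 1 := fun n ω => by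
    simp only [f]
    rw [mul_comm, Complex.norm_exp_ofReal_mul_I]
  have hfi : ∀ n, Integrable (f n) (phaseMeasure Q) := fun n =>
    Integrable.of_bound (C := 1) (hf n).aestronglyMeasurable
      (Eventually.of_forall fun ω => (hfn n ω).le)
  have hre : ∀ n, phaseCoeff Q n = (∫ ω, f n ω ∂phaseMeasure Q).re := fun n => by
    have := integral_re (hfi n)
    simp only [RCLike.re_to_complex] at this
    rw [← this, phaseCoeff]
    congr 1
    ext ω
    simp only [f]
    rw [mul_comm Complex.I, Complex.exp_ofReal_mul_I_re]
  have hbound : ∀ k : ℕ, ‖∫ ω, f (m * (k + 1)! + d) ω ∂phaseMeasure Q‖ * ‖1 - ζ‖ ≤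
      2 * Real.pi * |(d : ℝ)| / (k + 1)! := by
    intro k
    set n : ℤ := m * (k + 1)! + d with hn
    have h1 : ∫ ω, f n (phaseStep Q k ω) ∂phaseMeasure Q = ∫ ω, f n ω ∂phaseMeasure Q := by
      have hmp := measurePreserving_phaseStep (Q := Q) k
      conv_rhs => rw [← hmp.map_eq]
      rw [integral_map hmp.measurable.aemeasurable (hf n).aestronglyMeasurable]
    have h2 : (∫ ω, f n ω ∂phaseMeasure Q) * (1 - ζ) =
        ∫ ω, (f n (phaseStep Q k ω) - ζ * f n ω) ∂phaseMeasure Q := by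
      rw [integral_sub, h1, integral_const_mul]
      · ring
      · exact (measurePreserving_phaseStep k).integrable_comp_of_integrable (hfi n)
      · exact (hfi n).const_mul ζ
    rw [← norm_mul, h2]
    refine (norm_integral_le_of_norm_le_const (Eventually.of_forall fun ω => ?_)).trans_eq
      (by rw [probReal_univ, mul_one])
    obtain ⟨ε, hε, hstep⟩ := exists_phase_phaseStep hQ k ω
    have hfac : (0 : ℝ) < (k + 1)! := by positivity
    have h3 : f n (phaseStep Q k ω) = ζ * f n ω *
        Complex.exp (Complex.I * (2 * Real.pi * d * ((1 - ε * Q) / (Q * (k + 1)!)) : ℝ)) := by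
      have hper : Complex.exp (Complex.I * (-(2 * Real.pi * m * ε) : ℝ)) = 1 := by
        rcases hε with rfl | rfl
        · simp
        · rw [Complex.exp_eq_one_iff]
          refine ⟨-m, ?_⟩
          push_cast
          ring
      simp only [f, ζ]
      rw [hstep, ← Complex.exp_add, ← Complex.exp_add]
      conv_rhs => rw [← mul_one (Complex.exp _), ← hper, ← Complex.exp_add]
      congr 1
      rw [← mul_add, ← mul_add, ← mul_add]
      congr 1
      rw [hn]
      push_cast
      have : (Q : ℂ) ≠ 0 := by exact_mod_cast hQ0.ne'
      have : ((k + 1)! : ℂ) ≠ 0 := by exact_mod_cast hfac.ne'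
      field_simp
      ring
    have h4 : ‖ζ‖ = 1 := by
      simp only [ζ]
      rw [mul_comm, Complex.norm_exp_ofReal_mul_I]
    rw [h3, ← mul_sub_one, norm_mul, norm_mul, h4, hfn, one_mul, one_mul]
    refine Real.norm_exp_I_mul_ofReal_sub_one_le.trans ?_
    have h5 : |1 - ε * Q| ≤ Q := by
      have hQ1 : (2 : ℝ) ≤ Q := by exact_mod_cast hQ
      rcases hε with rfl | rfl
      · rw [abs_le]; constructor <;> linarith
      · rw [abs_le]; constructor <;> linarith
    rw [Real.norm_eq_abs, abs_mul, abs_mul, abs_of_pos Real.two_pi_pos, abs_div,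
      abs_of_pos (mul_pos hQ0 hfac), mul_div_assoc]
    have h6 : |1 - ε * Q| / (Q * (k + 1)!) ≤ 1 / (k + 1)! := by
      rw [div_le_div_iff₀ (by positivity) hfac, one_mul]
      gcongr
    calc 2 * Real.pi * |(d : ℝ)| * (|1 - ε * Q| / (Q * (k + 1)!))
        ≤ 2 * Real.pi * |(d : ℝ)| * (1 / (k + 1)!) := by gcongr
      _ = _ := by ring
  have hpos : 0 < ‖1 - ζ‖ := norm_pos_iff.2 (sub_ne_zero.2 hζ.symm)
  have hlim : Tendsto (fun k : ℕ => 2 * Real.pi * |(d : ℝ)| * (1 / ((k + 1)! : ℝ)) / ‖1 - ζ‖)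
      atTop (𝓝 0) := by
    have := (summable_one_div_factorial_succ.tendsto_atTop_zero.const_mul
      (2 * Real.pi * |(d : ℝ)|)).div_const ‖1 - ζ‖
    simpa using this
  refine squeeze_zero_norm (fun k => ?_) hlim
  rw [hre, Real.norm_eq_abs]
  refine (Complex.abs_re_le_norm _).trans ?_
  rw [le_div_iff₀ hpos]
  exact (hbound k).trans_eq (by ring)

lemma phaseCoeff_zero : phaseCoeff Q 0 = 1 := by
  simp [phaseCoeff]

variable (Q) in
/-- The coefficients `phaseCoeff Q` are the Gram matrix of a sequence in a real Hilbert space. -/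
lemma exists_inner_eq_phaseCoeff :
    ∃ v : ℤ → Lp ℂ 2 (phaseMeasure Q), ∀ i j, inner ℝ (v i) (v j) = phaseCoeff Q (j - i) := by
  let f : ℤ → (ℕ → ZMod Q) → ℂ := fun n ω =>
    Complex.exp ((2 * Real.pi * n * phase Q ω : ℝ) * Complex.I)
  have hf : ∀ n, Measurable (f n) := fun n => by
    have := measurable_phase (Q := Q)
    fun_prop
  have hfL : ∀ n, MemLp (f n) 2 (phaseMeasure Q) := fun n =>
    MemLp.of_bound (hf n).aestronglyMeasurable 1
      (Eventually.of_forall fun ω => (Complex.norm_exp_ofReal_mul_I _).le)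
  refine ⟨fun n => (hfL n).toLp, fun i j => ?_⟩
  rw [L2.inner_def, phaseCoeff]
  refine integral_congr_ae ?_
  filter_upwards [(hfL i).coeFn_toLp, (hfL j).coeFn_toLp] with ω h1 h2
  rw [h1, h2, Complex.inner]
  simp only [f]
  rw [← Complex.exp_conj, ← Complex.exp_add, ← Complex.exp_ofReal_mul_I_re]
  congr 2
  simp only [map_mul, Complex.conj_ofReal, Complex.conj_I]
  push_cast
  ring

end Phase

/-- For `Q ≥ 2` there is a weakly mixing automorphism for which the multiples `m (k+1)!` form a
rigidity sequence when `Q ∣ m`, and a mixing sequence otherwise. -/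
lemma exists_weaklyMixing_tendsto_corr_factorial {Q : ℕ} (hQ : 2 ≤ Q) :
    ∃ T : Aut01, T.WeaklyMixing ∧
      ∀ E F : Set unitInterval, MeasurableSet E → MeasurableSet F → ∀ m : ℤ,
        ((Q : ℤ) ∣ m → Tendsto (fun k : ℕ => T.corr (m * (k + 1).factorial) E F) atTop
          (𝓝 (volume.real (E ∩ F)))) ∧
        (¬ (Q : ℤ) ∣ m → Tendsto (fun k : ℕ => T.corr (m * (k + 1).factorial) E F) atTop
          (𝓝 (volume.real E * volume.real F))) := by
  have : NeZero Q := ⟨by omega⟩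
  obtain ⟨v, hv⟩ := exists_inner_eq_phaseCoeff Q
  obtain ⟨γ, hprob, hγ⟩ := exists_hasGramCharFun Equiv.intEquivNat v
  have h0 : ‖v 0‖ = 1 := by
    have h := hv 0 0
    rw [sub_self, phaseCoeff_zero, real_inner_self_eq_norm_sq] at h
    exact (pow_eq_one_iff_of_nonneg (norm_nonneg _) two_ne_zero).1 h
  have := hγ.nullSingletonClass h0
  let S : Equiv.Perm (ℤ → ℝ) :=
    ⟨shift 1, shift (-1), fun x => by ext; simp [shift], fun x => by ext; simp [shift]⟩
  have hS : ∀ m : ℤ, ⇑(S ^ m) = shift m := by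
    intro m
    induction m with
    | zero => ext x n; simp [shift]
    | succ m ih =>
      rw [zpow_add_one, Equiv.Perm.coe_mul, ih]
      ext x n
      simp [S, shift, add_assoc]
    | pred m ih =>
      rw [zpow_sub_one, Equiv.Perm.coe_mul, ih]
      ext x n
      simp only [Function.comp_apply, shift]
      change x (n + -↑m + -1) = _
      ring_nf
  obtain ⟨T, G, hG, hT⟩ := exists_aut01_corr_eq γ S (hγ.measurePreserving_shift hv 1)
    (hγ.measurePreserving_shift hv (-1))
  have hvol : ∀ E, MeasurableSet E → volume.real E = γ.real (G ⁻¹' E) := fun E hE => by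
    rw [Measure.real, Measure.real, hG.measure_preimage hE.nullMeasurableSet]
  have hcorr : ∀ E F, MeasurableSet E → MeasurableSet F → ∀ m,
      T.corr m E F = γ.real (G ⁻¹' E ∩ shift m ⁻¹' (G ⁻¹' F)) := fun E F hE hF m => by
    rw [hT m E F hE hF, hS]
  have hmix : ∀ E F : Set unitInterval, MeasurableSet E → MeasurableSet F → ∀ m : ℤ,
      ¬ (Q : ℤ) ∣ m → Tendsto (fun k : ℕ => T.corr (m * (k + 1).factorial) E F) atTop
        (𝓝 (volume.real E * volume.real F)) := by
    intro E F hE hF m hm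
    simp only [hcorr E F hE hF, hvol _ hE, hvol _ hF]
    exact hγ.tendsto_mixing hv (fun d => tendsto_phaseCoeff_of_not_dvd hQ hm d)
      (hG.measurable hE) (hG.measurable hF)
  refine ⟨T, T.weaklyMixing_of_tendsto (l := fun k => (k + 1).factorial) fun E F hE hF => ?_,
    fun E F hE hF m => ⟨?_, hmix E F hE hF m⟩⟩
  · have h1 : ¬ (Q : ℤ) ∣ 1 := fun h => by
      have := Int.le_of_dvd one_pos h
      omega
    simpa only [one_mul] using hmix E F hE hF 1 h1
  · rintro ⟨m, rfl⟩
    simp only [hcorr E F hE hF, hvol _ (hE.inter hF)]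
    exact hγ.tendsto_rigid hv (fun d => tendsto_phaseCoeff_of_dvd m d)
      (hG.measurable hE) (hG.measurable hF)

/-- Every set of indices is cut out among the `q j` by divisibility by some positive integer. -/
lemma exists_pos_dvd_iff_mem {ι κ : Type*} [Fintype ι] [Fintype κ] [DecidableEq ι]
    (A : κ → Finset ι) (hA_surj : ∀ S : Finset ι, S ≠ ∅ → S ≠ Finset.univ → ∃ i, A i = S)
    (p : κ → ℕ) (hp : ∀ i, Nat.Prime (p i)) (hp_inj : Function.Injective p)
    (q : ι → ℕ) (hq : ∀ j, q j = ∏ i ∈ Finset.univ.filter (fun i => j ∈ A i), p i)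
    (S : Finset ι) : ∃ P : ℕ, 0 < P ∧ ∀ j, P ∣ q j ↔ j ∈ S := by
  rcases eq_or_ne S Finset.univ with rfl | hS
  · exact ⟨1, one_pos, by simp⟩
  rcases eq_or_ne S ∅ with rfl | hS'
  · refine ⟨1 + ∑ j, q j, by omega, fun j => ?_⟩
    have h1 : 0 < q j := by
      rw [hq]
      exact Finset.prod_pos fun i _ => (hp i).pos
    have h2 : q j ≤ ∑ j, q j := Finset.single_le_sum (fun _ _ => Nat.zero_le _) (Finset.mem_univ j)
    simp only [Finset.notMem_empty, iff_false]
    exact fun h => by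
      have := Nat.le_of_dvd h1 h
      omega
  obtain ⟨i, rfl⟩ := hA_surj S hS' hS
  refine ⟨p i, (hp i).pos, fun j => ?_⟩
  rw [hq, (hp i).prime.dvd_finsetProd_iff]
  constructor
  · rintro ⟨i', hi', h⟩
    rw [← hp_inj ((Nat.prime_dvd_prime_iff_eq (hp i) (hp i')).1 h)] at hi'
    exact (Finset.mem_filter.1 hi').2
  · exact fun h => ⟨i, by simpa using h, dvd_rfl⟩


/-- Let `N ≥ 2`, let `A_1,…,A_{2^N-2}` enumerate the non-empty proper
subsets of `{1,…,N}`, let `p_1,…,p_{2^N-2}` be distinct primes, and set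
`q_j = Π_{n : j ∈ A_n} p_n`, `φ_j(k) = q_j k`. Then there is a strictly increasing
`(n_k)` such that for every `ξ ∈ {0,1}^N` there is a weakly mixing `T_ξ` with
`μ(A ∩ T_ξ^{-q_j n_k}B) → (1-ξ_j)μ(A∩B) + ξ_j μ(A)μ(B)` for each `j` and all
measurable `A,B`. -/
theorem stmt_14 (N : ℕ) (hN : 2 ≤ N)
    (A : Fin (2 ^ N - 2) → Finset (Fin N))
    (hA_inj : Function.Injective A)
    (hA_mem : ∀ i, A i ≠ ∅ ∧ A i ≠ Finset.univ)
    (hA_surj : ∀ S : Finset (Fin N), S ≠ ∅ → S ≠ Finset.univ → ∃ i, A i = S)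
    (p : Fin (2 ^ N - 2) → ℕ) (hp : ∀ i, Nat.Prime (p i))
    (hp_inj : Function.Injective p)
    (q : Fin N → ℕ)
    (hq : ∀ j, q j = ∏ i ∈ Finset.univ.filter (fun i => j ∈ A i), p i) :
    ∃ n : ℕ → ℕ, StrictMono n ∧
      ∀ ξ : Fin N → ℝ, (∀ j, ξ j = 0 ∨ ξ j = 1) →
        ∃ T : Aut01, T.WeaklyMixing ∧
          ∀ j : Fin N, ∀ E F : Set unitInterval, MeasurableSet E → MeasurableSet F →
            Tendsto (fun k => T.corr ((q j : ℤ) * (n k : ℤ)) E F) atTop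
              (𝓝 ((1 - ξ j) * (volume (E ∩ F)).toReal
                + ξ j * (volume E).toReal * (volume F).toReal)) := by
  classical
  refine ⟨fun k => 2 * (k + 1).factorial, fun a b hab => ?_, fun ξ hξ => ?_⟩
  · have := (Nat.factorial_lt (Nat.succ_pos a)).2 (Nat.succ_lt_succ hab)
    exact Nat.mul_lt_mul_of_pos_left this two_pos
  obtain ⟨P, hP, hPq⟩ := exists_pos_dvd_iff_mem A hA_surj p hp hp_inj q hq
    (Finset.univ.filter fun j => ξ j = 0)
  obtain ⟨T, hT, hcorr⟩ := exists_weaklyMixing_tendsto_corr_factorial (Q := 2 * P) (by omega)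
  refine ⟨T, hT, fun j E F hE hF => ?_⟩
  have hdvd : ((2 * P : ℕ) : ℤ) ∣ 2 * (q j : ℤ) ↔ ξ j = 0 := by
    have h := hPq j
    simp only [Finset.mem_filter, Finset.mem_univ, true_and] at h
    rw [← h, ← Nat.mul_dvd_mul_iff_left (Nat.succ_pos 1)]
    exact_mod_cast Iff.rfl
  have hseq : ∀ k : ℕ, (q j : ℤ) * ((2 * (k + 1).factorial : ℕ) : ℤ) =
      2 * (q j : ℤ) * (k + 1).factorial := fun k => by
    push_cast
    ring
  simp only [hseq]
  rcases hξ j with h | h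
  · simpa [h, Measure.real] using (hcorr E F hE hF (2 * (q j : ℤ))).1 (hdvd.2 h)
  · have hnd : ¬ ((2 * P : ℕ) : ℤ) ∣ 2 * (q j : ℤ) := by rw [hdvd, h]; exact one_ne_zero
    simpa [h, Measure.real] using (hcorr E F hE hF (2 * (q j : ℤ))).2 hnd
end
end
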